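/- arXiv:2102.05295 — 11 statements merged into one kernel-verified Lean document; each statement's English description precedes it below -/
import Mathlib

section
/- Let (Ω, 𝓕, P) be a probability space, T ≥ 1 an integer, and for each t ∈ {1,…,T} let c(t) : Ω → C be a random context whose law is p (i.e., P(c(t) = c₀) = p_{c₀} for every c₀ ∈ C) and let A(t) : Ω → {1,…,J} be an arbitrary random action (jointly measurable with c(t), with no adaptedness assumed). If for every k ∈ {1,…,K} one has E[Σ_{t=1}^T w^{(k)}(c(t), A(t))] ≤ 0, then E[Σ_{t=1}^T r(c(t), A(t))] ≤ T · sup { Σ_{c∈C} Σ_{j=1}^J p_c r(c,j) x_{c,j} : x is 0-feasible }. -/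
open MeasureTheory

/-- A family `x` is `ε`-feasible for the baseline LP. -/
def Feasible {C : Type*} {J K : ℕ} (p : C → ℝ) (w : Fin K → C → Fin J → ℝ) (ε : ℝ)
    (x : C → Fin J → ℝ) : Prop :=
  (∀ c j, 0 ≤ x c j) ∧ (∀ c, ∑ j, x c j = 1) ∧
    ∀ k, (∑' c, ∑ j, p c * w k c j * x c j) + ε ≤ 0

lemma aux_int {C : Type*} [Countable C] [MeasurableSpace C] [MeasurableSingletonClass C]
    {J : ℕ} {Ω : Type*} [MeasurableSpace Ω] (P : Measure Ω) [IsProbabilityMeasure P]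
    (Z : Ω → C × Fin J) (hZ : Measurable Z) (f : C → Fin J → ℝ) (hf : ∀ c j, |f c j| ≤ 1) :
    Integrable (fun ω => f (Z ω).1 (Z ω).2) P ∧
    HasSum (fun c₀ => ∑ j, P.real (Z ⁻¹' {(c₀, j)}) * f c₀ j)
      (∫ ω, f (Z ω).1 (Z ω).2 ∂P) := by
  have : IsProbabilityMeasure (P.map Z) := Measure.isProbabilityMeasure_map hZ.aemeasurable
  have hm : Measurable (fun a : C × Fin J => f a.1 a.2) := measurable_of_countable _
  have hi : Integrable (fun a : C × Fin J => f a.1 a.2) (P.map Z) :=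
    Integrable.of_bound hm.aestronglyMeasurable 1 (Filter.Eventually.of_forall fun a => hf _ _)
  refine ⟨hi.comp_measurable hZ, ?_⟩
  have h1 : ∫ ω, f (Z ω).1 (Z ω).2 ∂P = ∫ a, f a.1 a.2 ∂(P.map Z) :=
    (integral_map hZ.aemeasurable hm.aestronglyMeasurable).symm
  have h2 : HasSum (fun a : C × Fin J => P.real (Z ⁻¹' {a}) * f a.1 a.2)
      (∫ a, f a.1 a.2 ∂(P.map Z)) := by
    have h3 := hasSum_integral_measure (μ := fun a : C × Fin J => (P.map Z) {a} • Measure.dirac a)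
      (f := fun a : C × Fin J => f a.1 a.2) (by rwa [Measure.sum_smul_dirac])
    rw [Measure.sum_smul_dirac] at h3
    refine (funext fun a => ?_ : (fun a : C × Fin J => P.real (Z ⁻¹' {a}) * f a.1 a.2) = _) ▸ h3
    rw [integral_smul_measure, integral_dirac, smul_eq_mul, Measure.map_apply hZ (measurableSet_singleton a)]
    rfl
  rw [h1]
  exact h2.prod_fiberwise fun c₀ => hasSum_fintype _

/-- The expected cumulative reward of any policy that satisfies the expected cumulative
cost constraints over horizon `T` is at most `T` times the value of the baseline LP. -/
theorem stmt_0
    {C : Type*} [Countable C] [MeasurableSpace C] [MeasurableSingletonClass C]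
    {J K : ℕ} (hJ : 1 ≤ J) (hK : 1 ≤ K)
    (p : C → ℝ) (hp0 : ∀ c, 0 ≤ p c) (hp1 : ∀ c, p c ≤ 1) (hpsum : ∑' c, p c = 1)
    (r : C → Fin J → ℝ) (hr : ∀ c j, r c j ∈ Set.Icc (0 : ℝ) 1)
    (w : Fin K → C → Fin J → ℝ) (hw : ∀ k c j, w k c j ∈ Set.Icc (-1 : ℝ) 1)
    {Ω : Type*} [MeasurableSpace Ω] (P : Measure Ω) [IsProbabilityMeasure P]
    (T : ℕ) (hT : 1 ≤ T)
    (c : Fin T → Ω → C) (A : Fin T → Ω → Fin J)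
    (hmeas : ∀ t, Measurable (fun ω => (c t ω, A t ω)))
    (hlaw : ∀ t c₀, (P {ω | c t ω = c₀}).toReal = p c₀)
    (hcost : ∀ k, ∫ ω, (∑ t, w k (c t ω) (A t ω)) ∂P ≤ 0) :
    ∫ ω, (∑ t, r (c t ω) (A t ω)) ∂P ≤
      T * sSup {v : ℝ | ∃ x : C → Fin J → ℝ, Feasible p w 0 x ∧
        v = ∑' c₀, ∑ j, p c₀ * r c₀ j * x c₀ j} := by
  classical
  have hTpos : (0 : ℝ) < T := by exact_mod_cast hT
  have hJpos : (0 : ℝ) < J := by exact_mod_cast hJ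
  set Z : Fin T → Ω → C × Fin J := fun t ω => (c t ω, A t ω) with hZdef
  set q : Fin T → C → Fin J → ℝ := fun t c₀ j => P.real (Z t ⁻¹' {(c₀, j)}) with hq
  have hq0 : ∀ t c₀ j, 0 ≤ q t c₀ j := fun t c₀ j => measureReal_nonneg
  have hqs : ∀ t c₀, ∑ j, q t c₀ j = p c₀ := by
    intro t c₀
    rw [← hlaw t c₀]
    have hU : {ω | c t ω = c₀} = ⋃ j, Z t ⁻¹' {(c₀, j)} := by
      ext ω; simp [hZdef]
    change _ = P.real _
    rw [hU, measureReal_iUnion_fintype]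
    · intro i j hij
      refine Disjoint.preimage _ ?_
      simpa using fun h => hij h
    · exact fun j => hmeas t (measurableSet_singleton _)
  set x : C → Fin J → ℝ := fun c₀ j =>
    if p c₀ = 0 then 1 / (J : ℝ) else (∑ t, q t c₀ j) / (T * p c₀) with hx
  have hpx : ∀ c₀ j, p c₀ * x c₀ j = (∑ t, q t c₀ j) / T := by
    intro c₀ j
    by_cases h : p c₀ = 0
    · have : ∀ t, q t c₀ j = 0 := by
        intro t
        have h1 := hqs t c₀
        rw [h, Finset.sum_eq_zero_iff_of_nonneg (fun j _ => hq0 t c₀ j)] at h1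
        exact h1 j (Finset.mem_univ _)
      simp [h, this]
    · simp only [hx, if_neg h]
      field_simp
  have key : ∀ f : C → Fin J → ℝ, (∀ c₀ j, |f c₀ j| ≤ 1) →
      (∫ ω, (∑ t, f (c t ω) (A t ω)) ∂P) = T * ∑' c₀, ∑ j, p c₀ * f c₀ j * x c₀ j := by
    intro f hf
    have h := fun t => aux_int P (Z t) (hmeas t) f hf
    rw [integral_finsetSum _ (fun t _ => (h t).1)]
    have h2 := (hasSum_sum (s := Finset.univ) (fun t _ => (h t).2)).tsum_eq
    rw [← h2, ← tsum_mul_left]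
    refine tsum_congr fun c₀ => ?_
    rw [Finset.sum_comm, Finset.mul_sum]
    refine Finset.sum_congr rfl fun j _ => ?_
    rw [← Finset.sum_mul, mul_right_comm, hpx]
    field_simp
    exact mul_comm _ _
  have hr' : ∀ c₀ j, |r c₀ j| ≤ 1 := fun c₀ j =>
    abs_le.2 ⟨by linarith [(hr c₀ j).1], (hr c₀ j).2⟩
  rw [key r hr']
  have hps : Summable p := by
    by_contra h
    rw [tsum_eq_zero_of_not_summable h] at hpsum
    exact zero_ne_one hpsum
  refine mul_le_mul_of_nonneg_left (le_csSup ?_ ⟨x, ⟨?_, ?_, ?_⟩, rfl⟩) hTpos.le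
  · refine ⟨1, ?_⟩
    rintro v ⟨y, ⟨hy0, hy1, -⟩, rfl⟩
    have hle : ∀ c₀, ∑ j, p c₀ * r c₀ j * y c₀ j ≤ p c₀ := by
      intro c₀
      calc ∑ j, p c₀ * r c₀ j * y c₀ j ≤ ∑ j, p c₀ * y c₀ j := by
            refine Finset.sum_le_sum fun j _ => mul_le_mul_of_nonneg_right ?_ (hy0 _ _)
            exact mul_le_of_le_one_right (hp0 _) (hr _ _).2
        _ = p c₀ := by rw [← Finset.mul_sum, hy1, mul_one]
    have h0 : ∀ c₀, 0 ≤ ∑ j, p c₀ * r c₀ j * y c₀ j := fun c₀ =>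
      Finset.sum_nonneg fun j _ => mul_nonneg (mul_nonneg (hp0 _) (hr _ _).1) (hy0 _ _)
    rw [← hpsum]
    exact (Summable.of_nonneg_of_le h0 hle hps).tsum_le_tsum hle hps
  · intro c₀ j
    simp only [hx]
    split_ifs
    · positivity
    · exact div_nonneg (Finset.sum_nonneg fun t _ => hq0 _ _ _) (mul_nonneg hTpos.le (hp0 _))
  · intro c₀
    by_cases h : p c₀ = 0
    · simp only [hx, if_pos h]
      simp [hJpos.ne']
    · simp only [hx, if_neg h]
      rw [← Finset.sum_div, Finset.sum_comm]
      simp only [hqs]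
      simp [hTpos.ne', h]
  · intro k
    have h1 := hcost k
    rw [key (w k) (fun c₀ j => abs_le.2 (hw k c₀ j))] at h1
    rw [add_zero]
    exact nonpos_of_mul_nonpos_right h1 hTpos
end

section
/- Let δ ∈ (0,1] and suppose there is a Slater point x^{in} with constant δ. Let 0 ≤ ε ≤ δ. Let x* be any 0-feasible family and let x^{ε,*} be an ε-feasible family that is optimal among ε-feasible families, i.e., Σ_{c∈C} Σ_{j=1}^J p_c r(c,j) x^{ε,*}_{c,j} ≥ Σ_{c∈C} Σ_{j=1}^J p_c r(c,j) y_{c,j} for every ε-feasible family y. Then Σ_{c∈C} Σ_{j=1}^J p_c r(c,j) (x*_{c,j} − x^{ε,*}_{c,j}) ≤ ε/δ. -/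
theorem aux_bound {J : ℕ} (a : ℝ) (ha : 0 ≤ a) (f x : Fin J → ℝ)
    (hf : ∀ j, |f j| ≤ 1) (hx0 : ∀ j, 0 ≤ x j) (hx1 : ∑ j, x j = 1) :
    |∑ j, a * f j * x j| ≤ a := by
  calc |∑ j, a * f j * x j| ≤ ∑ j, |a * f j * x j| := Finset.abs_sum_le_sum_abs _ _
    _ ≤ ∑ j, a * x j := by
        refine Finset.sum_le_sum fun j _ => ?_
        rw [abs_mul, abs_mul, abs_of_nonneg ha, abs_of_nonneg (hx0 j)]
        exact mul_le_mul_of_nonneg_right (mul_le_of_le_one_right ha (hf j)) (hx0 j)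
    _ = a := by rw [← Finset.mul_sum, hx1, mul_one]

theorem aux_summable {C : Type*} {J : ℕ} (p : C → ℝ) (hp0 : ∀ c, 0 ≤ p c) (hs : Summable p)
    (f x : C → Fin J → ℝ) (hf : ∀ c j, |f c j| ≤ 1) (hx0 : ∀ c j, 0 ≤ x c j)
    (hx1 : ∀ c, ∑ j, x c j = 1) : Summable fun c => ∑ j, p c * f c j * x c j :=
  Summable.of_norm_bounded hs fun c => aux_bound (p c) (hp0 c) (f c) (x c) (hf c) (hx0 c) (hx1 c)

theorem aux_comb {C : Type*} {J : ℕ} (p : C → ℝ) (f x y : C → Fin J → ℝ) (a b : ℝ)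
    (hx : Summable fun c => ∑ j, p c * f c j * x c j)
    (hy : Summable fun c => ∑ j, p c * f c j * y c j) :
    ∑' c, ∑ j, p c * f c j * (a * x c j + b * y c j) =
      a * (∑' c, ∑ j, p c * f c j * x c j) + b * ∑' c, ∑ j, p c * f c j * y c j := by
  rw [← tsum_mul_left, ← tsum_mul_left, ← (hx.mul_left a).tsum_add (hy.mul_left b)]
  refine tsum_congr fun c => ?_
  rw [Finset.mul_sum, Finset.mul_sum, ← Finset.sum_add_distrib]
  exact Finset.sum_congr rfl fun j _ => by ring

/-- Under Slater's condition with constant `δ`, the gap in LP value between the original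
problem and its `ε`-tightened version is at most `ε / δ`. -/
theorem stmt_1
    {C : Type*} [Countable C]
    {J K : ℕ} (hJ : 1 ≤ J) (hK : 1 ≤ K)
    (p : C → ℝ) (hp0 : ∀ c, 0 ≤ p c) (hp1 : ∀ c, p c ≤ 1) (hpsum : ∑' c, p c = 1)
    (r : C → Fin J → ℝ) (hr : ∀ c j, r c j ∈ Set.Icc (0 : ℝ) 1)
    (w : Fin K → C → Fin J → ℝ) (hw : ∀ k c j, w k c j ∈ Set.Icc (-1 : ℝ) 1)
    (δ : ℝ) (hδ : δ ∈ Set.Ioc (0 : ℝ) 1)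
    (xin : C → Fin J → ℝ)
    (hin0 : ∀ c j, 0 ≤ xin c j) (hin1 : ∀ c, ∑ j, xin c j = 1)
    (hinslater : ∀ k, (∑' c, ∑ j, p c * w k c j * xin c j) ≤ -δ)
    (ε : ℝ) (hε0 : 0 ≤ ε) (hεδ : ε ≤ δ)
    (xs : C → Fin J → ℝ) (hxs : Feasible p w 0 xs)
    (xe : C → Fin J → ℝ) (hxe : Feasible p w ε xe)
    (hxeopt : ∀ y : C → Fin J → ℝ, Feasible p w ε y →
      (∑' c, ∑ j, p c * r c j * y c j) ≤ ∑' c, ∑ j, p c * r c j * xe c j) :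
    (∑' c, ∑ j, p c * r c j * (xs c j - xe c j)) ≤ ε / δ := by
  have hs : Summable p := by
    by_contra h
    rw [tsum_eq_zero_of_not_summable h] at hpsum
    exact zero_ne_one hpsum
  obtain ⟨hδ0, -⟩ := hδ
  obtain ⟨hs0, hs1, hsw⟩ := hxs
  obtain ⟨he0, he1, -⟩ := hxe
  have hw' : ∀ k c j, |w k c j| ≤ 1 := fun k c j => abs_le.2 (hw k c j)
  have hr' : ∀ c j, |r c j| ≤ 1 := fun c j => abs_le.2 ⟨by linarith [(hr c j).1], (hr c j).2⟩
  have ht0 : 0 ≤ ε / δ := div_nonneg hε0 hδ0.le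
  have ht1 : ε / δ ≤ 1 := (div_le_one hδ0).2 hεδ
  have htd : ε / δ * δ = ε := div_mul_cancel₀ _ hδ0.ne'
  generalize ε / δ = t at ht0 ht1 htd ⊢
  have Rs := aux_summable p hp0 hs r xs hr' hs0 hs1
  have Ri := aux_summable p hp0 hs r xin hr' hin0 hin1
  have Re := aux_summable p hp0 hs r xe hr' he0 he1
  have hfeas : Feasible p w ε (fun c j => (1 - t) * xs c j + t * xin c j) := by
    refine ⟨fun c j => ?_, fun c => ?_, fun k => ?_⟩
    · exact add_nonneg (mul_nonneg (by linarith) (hs0 c j)) (mul_nonneg ht0 (hin0 c j))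
    · rw [Finset.sum_add_distrib, ← Finset.mul_sum, ← Finset.mul_sum, hs1, hin1]; ring
    · rw [aux_comb p (w k) xs xin (1 - t) t (aux_summable p hp0 hs _ _ (hw' k) hs0 hs1)
        (aux_summable p hp0 hs _ _ (hw' k) hin0 hin1)]
      have h1 := hsw k
      have h2 := mul_le_mul_of_nonneg_left (hinslater k) ht0
      have h3 := mul_le_mul_of_nonneg_left h1 (sub_nonneg.2 ht1)
      linarith
  have hopt := hxeopt _ hfeas
  rw [aux_comb p r xs xin (1 - t) t Rs Ri] at hopt
  have hgap := aux_comb p r xs xe 1 (-1) Rs Re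
  have hsimp : ∀ c j, 1 * xs c j + -1 * xe c j = xs c j - xe c j := fun c j => by ring
  simp only [hsimp] at hgap
  rw [hgap]
  have hin : 0 ≤ ∑' c, ∑ j, p c * r c j * xin c j :=
    tsum_nonneg fun c => Finset.sum_nonneg fun j _ =>
      mul_nonneg (mul_nonneg (hp0 c) (hr c j).1) (hin0 c j)
  have hle : ∑' c, ∑ j, p c * r c j * xs c j ≤ 1 := by
    rw [← hpsum]
    exact Rs.tsum_le_tsum (fun c => (le_abs_self _).trans
      (aux_bound (p c) (hp0 c) (r c) (xs c) (hr' c) (hs0 c) (hs1 c))) hs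
  have h4 := mul_nonneg ht0 hin
  have h5 := mul_le_mul_of_nonneg_left hle ht0
  linarith
end

section
/- Suppose |r̂(c₀,j)| ≤ 1 for all c₀ ∈ C and j ∈ {1,…,J}. Then for every family y = (y_{c,j})_{c∈C, j∈{1,…,J}} with y_{c,j} ≥ 0 and Σ_{j=1}^J y_{c,j} = 1 for every c ∈ C, one has E[ Σ_{k=1}^K Q_k W^{(k)}_{J*} − V r̂(c, J*) ] ≤ Σ_{k=1}^K Q_k Σ_{c₀∈C} Σ_{j=1}^J p_{c₀} w^{(k)}(c₀,j) y_{c₀,j} − V Σ_{c₀∈C} Σ_{j=1}^J p_{c₀} r̂(c₀,j) y_{c₀,j}. -/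
open MeasureTheory

theorem aux_hasSum {C : Type*} [Countable C] [MeasurableSpace C] [MeasurableSingletonClass C]
    {Ω : Type*} [MeasurableSpace Ω] (P : Measure Ω) [IsProbabilityMeasure P]
    (c : Ω → C) (hc : Measurable c) (X : Ω → ℝ) (hX : Measurable X) (hb : ∀ ω, |X ω| ≤ 1)
    (m : C → ℝ) (hm : ∀ c₀, ∫ ω in {ω | c ω = c₀}, X ω ∂P = m c₀)
    (g : C → ℝ) (hg : ∀ c₀, |g c₀| ≤ 1) :
    Integrable (fun ω => X ω * g (c ω)) P ∧
    HasSum (fun c₀ => m c₀ * g c₀) (∫ ω, X ω * g (c ω) ∂P) := by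
  have hgm : Measurable g := measurable_of_countable g
  have hint : Integrable (fun ω => X ω * g (c ω)) P := by
    refine Integrable.of_bound (hX.mul (hgm.comp hc)).aestronglyMeasurable 1 (ae_of_all _ ?_)
    intro ω
    rw [Real.norm_eq_abs, abs_mul]
    exact mul_le_one₀ (hb ω) (abs_nonneg _) (hg _)
  refine ⟨hint, ?_⟩
  have hs : ∀ c₀, MeasurableSet {ω | c ω = c₀} := fun c₀ => hc (measurableSet_singleton c₀)
  have hU : (⋃ c₀, {ω | c ω = c₀}) = Set.univ := by ext ω; simp
  have h := hasSum_integral_iUnion (μ := P) (f := fun ω => X ω * g (c ω)) hs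
    (by
      intro a b hab
      refine Set.disjoint_left.2 ?_
      intro ω h1 h2
      exact hab (h1.symm.trans h2)) hint.integrableOn
  rw [hU, setIntegral_univ] at h
  suffices he : (fun c₀ => m c₀ * g c₀)
      = fun c₀ => ∫ ω in {ω | c ω = c₀}, X ω * g (c ω) ∂P by
    rw [he]
    exact h
  funext c₀
  rw [← hm c₀, ← integral_mul_const]
  refine setIntegral_congr_fun (hs c₀) ?_
  intro ω hω
  have : c ω = c₀ := hω
  simp [this]

/-- The greedy MaxValue action `J*` minimizes the expected pseudo-Lagrangian:
`E[Σ_k Q_k W^(k)_{J*} − V r̂(c, J*)]` is at most the corresponding quantity under any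
randomized decision rule `y`. -/
theorem stmt_3
    {C : Type*} [Countable C] [MeasurableSpace C] [MeasurableSingletonClass C]
    {J K : ℕ} (hJ : 1 ≤ J) (hK : 1 ≤ K)
    (p : C → ℝ) (hp0 : ∀ c, 0 ≤ p c) (hp1 : ∀ c, p c ≤ 1) (hpsum : ∑' c, p c = 1)
    (w : Fin K → C → Fin J → ℝ) (hw : ∀ k c j, w k c j ∈ Set.Icc (-1 : ℝ) 1)
    {Ω : Type*} [MeasurableSpace Ω] (P : Measure Ω) [IsProbabilityMeasure P]
    (c : Ω → C) (hc : Measurable c)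
    (hlaw : ∀ c₀, (P {ω | c ω = c₀}).toReal = p c₀)
    (W : Fin K → Fin J → Ω → ℝ)
    (hWmeas : ∀ k j, Measurable (W k j))
    (hWbd : ∀ k j ω, |W k j ω| ≤ 1)
    (hWlaw : ∀ k j c₀, ∫ ω in {ω | c ω = c₀}, W k j ω ∂P = p c₀ * w k c₀ j)
    (Q : Fin K → ℝ) (hQ : ∀ k, 0 ≤ Q k)
    (V : ℝ) (hV : 0 ≤ V)
    (rhat : C → Fin J → ℝ) (hrhat : ∀ c₀ j, |rhat c₀ j| ≤ 1)
    (Jstar : Ω → Fin J) (hJstarMeas : Measurable Jstar)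
    (hJstarOpt : ∀ᵐ ω ∂P, ∀ j : Fin J,
      V * rhat (c ω) j - ∑ k, Q k * W k j ω ≤
        V * rhat (c ω) (Jstar ω) - ∑ k, Q k * W k (Jstar ω) ω)
    (y : C → Fin J → ℝ)
    (hy0 : ∀ c₀ j, 0 ≤ y c₀ j) (hy1 : ∀ c₀, ∑ j, y c₀ j = 1) :
    ∫ ω, (∑ k, Q k * W k (Jstar ω) ω - V * rhat (c ω) (Jstar ω)) ∂P ≤
      ∑ k, Q k * (∑' c₀, ∑ j, p c₀ * w k c₀ j * y c₀ j)
        - V * ∑' c₀, ∑ j, p c₀ * rhat c₀ j * y c₀ j := by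
  have hyle : ∀ c₀ j, |y c₀ j| ≤ 1 := by
    intro c₀ j
    rw [abs_of_nonneg (hy0 c₀ j), ← hy1 c₀]
    exact Finset.single_le_sum (fun i _ => hy0 c₀ i) (Finset.mem_univ j)
  have hs : ∀ c₀, MeasurableSet {ω | c ω = c₀} := fun c₀ => hc (measurableSet_singleton c₀)
  have hrm : ∀ j, Measurable (fun ω => rhat (c ω) j) := fun j =>
    (measurable_of_countable (fun c₀ => rhat c₀ j)).comp hc
  have hA := fun k j => aux_hasSum P c hc (W k j) (hWmeas k j) (hWbd k j)
    (fun c₀ => p c₀ * w k c₀ j) (hWlaw k j) (fun c₀ => y c₀ j) (fun c₀ => hyle c₀ j)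
  have hB := fun j => aux_hasSum P c hc (fun ω => rhat (c ω) j) (hrm j) (fun ω => hrhat _ j)
    (fun c₀ => p c₀ * rhat c₀ j) (by
      intro c₀
      rw [setIntegral_congr_fun (g := fun _ => rhat c₀ j) (hs c₀)]
      · rw [setIntegral_const, smul_eq_mul, Measure.real, hlaw]
      · intro ω hω
        have : c ω = c₀ := hω
        simp [this]) (fun c₀ => y c₀ j) (fun c₀ => hyle c₀ j)
  have hA' : ∀ k, ∑' c₀, ∑ j, p c₀ * w k c₀ j * y c₀ j
      = ∑ j, ∫ ω, W k j ω * y (c ω) j ∂P := fun k =>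
    (hasSum_sum (fun j _ => (hA k j).2)).tsum_eq
  have hB' : ∑' c₀, ∑ j, p c₀ * rhat c₀ j * y c₀ j
      = ∑ j, ∫ ω, rhat (c ω) j * y (c ω) j ∂P :=
    (hasSum_sum (fun j _ => (hB j).2)).tsum_eq
  have hI1 : ∀ k, Integrable (fun ω => ∑ j, W k j ω * y (c ω) j) P := fun k =>
    integrable_finsetSum _ (fun j _ => (hA k j).1)
  have hI2 : Integrable (fun ω => ∑ j, rhat (c ω) j * y (c ω) j) P :=
    integrable_finsetSum _ (fun j _ => (hB j).1)
  have hI3 : Integrable (fun ω => ∑ k, Q k * ∑ j, W k j ω * y (c ω) j) P :=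
    integrable_finsetSum _ (fun k _ => (hI1 k).const_mul _)
  have hR : ∑ k, Q k * (∑' c₀, ∑ j, p c₀ * w k c₀ j * y c₀ j)
        - V * ∑' c₀, ∑ j, p c₀ * rhat c₀ j * y c₀ j
      = ∫ ω, (∑ k, Q k * ∑ j, W k j ω * y (c ω) j)
          - V * ∑ j, rhat (c ω) j * y (c ω) j ∂P := by
    rw [integral_sub hI3 (hI2.const_mul V), integral_const_mul,
      integral_finsetSum _ (fun k _ => (hI1 k).const_mul _),
      integral_finsetSum _ (fun j _ => (hB j).1), hB']
    congr 1
    refine Finset.sum_congr rfl (fun k _ => ?_)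
    rw [hA', integral_const_mul, integral_finsetSum _ (fun j _ => (hA k j).1)]
  have hsel : ∀ X : Fin J → Ω → ℝ, (∀ j, Measurable (X j)) → (∀ j ω, |X j ω| ≤ 1) →
      Integrable (fun ω => X (Jstar ω) ω) P := by
    intro X hX hb
    refine Integrable.of_bound (Measurable.aestronglyMeasurable ?_) 1
      (ae_of_all _ (fun ω => hb _ ω))
    have : (fun ω => X (Jstar ω) ω)
        = fun ω => ∑ j, (Jstar ⁻¹' {j}).indicator (X j) ω := by
      funext ω
      rw [Finset.sum_eq_single (Jstar ω)]
      · exact (Set.indicator_of_mem (s := Jstar ⁻¹' {Jstar ω}) rfl (X (Jstar ω))).symm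
      · intro b _ hb'
        have hn : ω ∉ Jstar ⁻¹' {b} := fun h => hb' (Eq.symm h)
        exact Set.indicator_of_notMem hn (X b)
      · intro h
        exact absurd (Finset.mem_univ _) h
    rw [this]
    exact Finset.measurable_sum _ (fun j _ =>
      (hX j).indicator (hJstarMeas (measurableSet_singleton j)))
  rw [hR]
  refine integral_mono_ae ?_ (hI3.sub (hI2.const_mul V)) ?_
  · exact (integrable_finsetSum _ (fun k _ =>
      (hsel (W k) (hWmeas k) (hWbd k)).const_mul (Q k))).sub
      ((hsel (fun j ω => rhat (c ω) j) hrm (fun j ω => hrhat _ j)).const_mul V)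
  · filter_upwards [hJstarOpt] with ω hω
    show (∑ k, Q k * W k (Jstar ω) ω - V * rhat (c ω) (Jstar ω)) ≤
      (∑ k, Q k * ∑ j, W k j ω * y (c ω) j) - V * ∑ j, rhat (c ω) j * y (c ω) j
    have e : (∑ k, Q k * ∑ j, W k j ω * y (c ω) j) - V * ∑ j, rhat (c ω) j * y (c ω) j
        = ∑ j, y (c ω) j * (∑ k, Q k * W k j ω - V * rhat (c ω) j) := by
      simp only [Finset.mul_sum, mul_sub, Finset.sum_sub_distrib]
      rw [Finset.sum_comm]
      congr 1
      · exact Finset.sum_congr rfl fun j _ => Finset.sum_congr rfl fun k _ => by ring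
      · exact Finset.sum_congr rfl fun j _ => by ring
    rw [e]
    calc _ = ∑ j, y (c ω) j * (∑ k, Q k * W k (Jstar ω) ω - V * rhat (c ω) (Jstar ω)) := by
            rw [← Finset.sum_mul, hy1, one_mul]
      _ ≤ _ := Finset.sum_le_sum fun j _ =>
            mul_le_mul_of_nonneg_left (by linarith [hω j]) (hy0 _ j)
end

section
/- Suppose r̂ takes values in [0,1], δ ∈ (0,1], there is a Slater point x^{in} with constant δ, and 0 ≤ ε ≤ δ/2. For each k ∈ {1,…,K} define the updated dual variable Q'_k = max(Q_k + W^{(k)}_{J*} + ε, 0). Then E[ (1/2) Σ_{k=1}^K (Q'_k)² − (1/2) Σ_{k=1}^K Q_k² ] ≤ −(δ/2) Σ_{k=1}^K Q_k + V + K(1 + ε²). -/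
open MeasureTheory

/-- One-step expected Lyapunov drift bound for the dual update under Slater's condition:
`E[ ½Σ_k Q'_k² − ½Σ_k Q_k² ] ≤ −(δ/2) Σ_k Q_k + V + K (1 + ε²)`. -/
theorem stmt_4
    {C : Type*} [Countable C] [MeasurableSpace C] [MeasurableSingletonClass C]
    {J K : ℕ} (hJ : 1 ≤ J) (hK : 1 ≤ K)
    (p : C → ℝ) (hp0 : ∀ c, 0 ≤ p c) (hp1 : ∀ c, p c ≤ 1) (hpsum : ∑' c, p c = 1)
    (w : Fin K → C → Fin J → ℝ) (hw : ∀ k c j, w k c j ∈ Set.Icc (-1 : ℝ) 1)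
    (δ : ℝ) (hδ : δ ∈ Set.Ioc (0 : ℝ) 1)
    (xin : C → Fin J → ℝ)
    (hin0 : ∀ c j, 0 ≤ xin c j) (hin1 : ∀ c, ∑ j, xin c j = 1)
    (hinslater : ∀ k, (∑' c, ∑ j, p c * w k c j * xin c j) ≤ -δ)
    {Ω : Type*} [MeasurableSpace Ω] (P : Measure Ω) [IsProbabilityMeasure P]
    (c : Ω → C) (hc : Measurable c)
    (hlaw : ∀ c₀, (P {ω | c ω = c₀}).toReal = p c₀)
    (W : Fin K → Fin J → Ω → ℝ)
    (hWmeas : ∀ k j, Measurable (W k j))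
    (hWbd : ∀ k j ω, |W k j ω| ≤ 1)
    (hWlaw : ∀ k j c₀, ∫ ω in {ω | c ω = c₀}, W k j ω ∂P = p c₀ * w k c₀ j)
    (Q : Fin K → ℝ) (hQ : ∀ k, 0 ≤ Q k)
    (V : ℝ) (hV : 0 ≤ V)
    (rhat : C → Fin J → ℝ) (hrhat : ∀ c₀ j, rhat c₀ j ∈ Set.Icc (0 : ℝ) 1)
    (Jstar : Ω → Fin J) (hJstarMeas : Measurable Jstar)
    (hJstarOpt : ∀ᵐ ω ∂P, ∀ j : Fin J,
      V * rhat (c ω) j - ∑ k, Q k * W k j ω ≤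
        V * rhat (c ω) (Jstar ω) - ∑ k, Q k * W k (Jstar ω) ω)
    (ε : ℝ) (hε0 : 0 ≤ ε) (hεδ : ε ≤ δ / 2)
    (Q' : Fin K → Ω → ℝ)
    (hQ' : ∀ k ω, Q' k ω = max (Q k + W k (Jstar ω) ω + ε) 0) :
    ∫ ω, ((1 / 2) * ∑ k, (Q' k ω) ^ 2 - (1 / 2) * ∑ k, (Q k) ^ 2) ∂P ≤
      -(δ / 2) * ∑ k, Q k + V + K * (1 + ε ^ 2) := by
  classical
  obtain ⟨hδ0, hδ1⟩ := hδ
  have hxle : ∀ c₀ j, xin c₀ j ≤ 1 := by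
    intro c₀ j
    rw [← hin1 c₀]
    exact Finset.single_le_sum (fun i _ => hin0 c₀ i) (Finset.mem_univ j)
  have hxm : ∀ j, Measurable (fun ω => xin (c ω) j) := fun j =>
    (measurable_of_countable (fun c₀ => xin c₀ j)).comp hc
  have hxWint : ∀ k j, Integrable (fun ω => xin (c ω) j * W k j ω) P := by
    intro k j
    refine Integrable.of_bound ((hxm j).mul (hWmeas k j)).aestronglyMeasurable 1 ?_
    refine Filter.Eventually.of_forall fun ω => ?_
    rw [Real.norm_eq_abs, abs_mul, abs_of_nonneg (hin0 _ _)]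
    exact mul_le_one₀ (hxle _ _) (abs_nonneg _) (hWbd _ _ _)
  have hgint : ∀ k, Integrable (fun ω => ∑ j, xin (c ω) j * W k j ω) P := fun k =>
    integrable_finsetSum _ fun j _ => hxWint k j
  have hms : ∀ c₀, MeasurableSet {ω | c ω = c₀} := fun c₀ => hc (measurableSet_singleton c₀)
  have hg : ∀ k, ∫ ω, ∑ j, xin (c ω) j * W k j ω ∂P ≤ -δ := by
    intro k
    have hU : (⋃ c₀, {ω | c ω = c₀}) = Set.univ := by
      ext ω; simp
    have hd : Pairwise (Function.onFun Disjoint fun c₀ => {ω | c ω = c₀}) := by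
      intro a b hab
      refine Set.disjoint_left.2 fun ω h1 h2 => hab ?_
      exact (show c ω = a from h1).symm.trans h2
    have h1 := integral_iUnion (μ := P) hms hd (hgint k).integrableOn
    rw [hU, setIntegral_univ] at h1
    rw [h1]
    refine le_trans (le_of_eq ?_) (hinslater k)
    refine tsum_congr fun c₀ => ?_
    have h2 : ∫ ω in {ω | c ω = c₀}, ∑ j, xin (c ω) j * W k j ω ∂P
        = ∫ ω in {ω | c ω = c₀}, ∑ j, xin c₀ j * W k j ω ∂P := by
      refine setIntegral_congr_fun (hms c₀) fun ω hω => ?_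
      have : c ω = c₀ := hω
      simp only [this]
    have hWint : ∀ j, Integrable (W k j) P := fun j =>
      Integrable.of_bound (hWmeas k j).aestronglyMeasurable 1
        (Filter.Eventually.of_forall fun ω => hWbd k j ω)
    rw [h2, integral_finsetSum _ fun j _ => ((hWint j).const_mul _).integrableOn]
    refine Finset.sum_congr rfl fun j _ => ?_
    rw [integral_const_mul, hWlaw]
    ring
  have hWJm : ∀ k, Measurable (fun ω => W k (Jstar ω) ω) := by
    intro k
    have : Measurable (fun q : Fin J × Ω => W k q.1 q.2) :=
      measurable_from_prod_countable_right fun j => hWmeas k j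
    exact this.comp (hJstarMeas.prodMk measurable_id)
  have hsq : ∀ k ω, (Q' k ω) ^ 2 ≤ (Q k + W k (Jstar ω) ω + ε) ^ 2 := by
    intro k ω
    rw [hQ']
    rcases max_cases (Q k + W k (Jstar ω) ω + ε) 0 with h | h
    · rw [h.1]
    · rw [h.1]; nlinarith [sq_nonneg (Q k + W k (Jstar ω) ω + ε)]
  have hQint : ∀ k, Integrable (fun ω => (Q' k ω) ^ 2) P := by
    intro k
    have hm : Measurable (Q' k) := by
      have : Q' k = fun ω => max (Q k + W k (Jstar ω) ω + ε) 0 := funext (hQ' k)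
      rw [this]
      exact (((hWJm k).const_add _).add_const _).max measurable_const
    refine Integrable.of_bound (hm.pow_const 2).aestronglyMeasurable ((Q k + 1 + ε) ^ 2) ?_
    refine Filter.Eventually.of_forall fun ω => ?_
    rw [Real.norm_eq_abs, abs_of_nonneg (sq_nonneg _)]
    refine (hsq k ω).trans ?_
    have := abs_le.1 (hWbd k (Jstar ω) ω)
    have := hQ k
    apply sq_le_sq'  <;> linarith
  have hLint : Integrable
      (fun ω => (1 / 2) * ∑ k, (Q' k ω) ^ 2 - (1 / 2) * ∑ k, (Q k) ^ 2) P :=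
    ((integrable_finsetSum _ fun k _ => hQint k).const_mul _).sub (integrable_const _)
  have hSint : Integrable (fun ω => ∑ k, Q k * ∑ j, xin (c ω) j * W k j ω) P :=
    integrable_finsetSum _ fun k _ => (hgint k).const_mul _
  have hpt : ∀ᵐ ω ∂P, (1 / 2) * ∑ k, (Q' k ω) ^ 2 - (1 / 2) * ∑ k, (Q k) ^ 2 ≤
      (∑ k, Q k * ∑ j, xin (c ω) j * W k j ω) + (ε * ∑ k, Q k + V + K * (1 + ε ^ 2)) := by
    filter_upwards [hJstarOpt] with ω hω
    have hA : (1 / 2) * ∑ k, (Q' k ω) ^ 2 - (1 / 2) * ∑ k, (Q k) ^ 2 ≤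
        ∑ k, Q k * W k (Jstar ω) ω + ε * ∑ k, Q k + K * (1 + ε ^ 2) := by
      have hs : ∑ k, (Q' k ω) ^ 2 ≤
          ∑ k, (Q k ^ 2 + 2 * (Q k * W k (Jstar ω) ω) + 2 * ε * Q k + 2 * (1 + ε ^ 2)) := by
        refine Finset.sum_le_sum fun k _ => (hsq k ω).trans ?_
        have h1 : W k (Jstar ω) ω ^ 2 ≤ 1 := (sq_le_one_iff_abs_le_one _).2 (hWbd _ _ _)
        nlinarith [sq_nonneg (W k (Jstar ω) ω - ε)]
      simp only [Finset.sum_add_distrib, ← Finset.mul_sum, Finset.sum_const, Finset.card_univ,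
        Fintype.card_fin, nsmul_eq_mul] at hs
      linarith
    have hB : ∑ k, Q k * W k (Jstar ω) ω ≤ V + ∑ k, Q k * ∑ j, xin (c ω) j * W k j ω := by
      have hj : ∀ j, ∑ k, Q k * W k (Jstar ω) ω - V ≤ ∑ k, Q k * W k j ω := by
        intro j
        have := hω j
        have h1 := mul_nonneg hV (hrhat (c ω) j).1
        have h2 := mul_le_mul_of_nonneg_left (hrhat (c ω) (Jstar ω)).2 hV
        linarith
      have h3 := Finset.sum_le_sum fun j (_ : j ∈ Finset.univ) =>
        mul_le_mul_of_nonneg_left (hj j) (hin0 (c ω) j)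
      rw [← Finset.sum_mul, hin1, one_mul] at h3
      have h4 : ∑ j, xin (c ω) j * ∑ k, Q k * W k j ω
          = ∑ k, Q k * ∑ j, xin (c ω) j * W k j ω := by
        simp only [Finset.mul_sum]
        rw [Finset.sum_comm]
        exact Finset.sum_congr rfl fun k _ => Finset.sum_congr rfl fun j _ => by ring
      linarith
    linarith
  refine (integral_mono_ae hLint (hSint.add (integrable_const _)) hpt).trans ?_
  simp only [Pi.add_apply]
  rw [integral_add hSint (integrable_const _), integral_const,
    integral_finsetSum _ fun k _ => (hgint k).const_mul _]
  simp only [integral_const_mul, probReal_univ, one_smul]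
  have h5 : ∑ k, Q k * ∫ ω, ∑ j, xin (c ω) j * W k j ω ∂P ≤ ∑ k, Q k * (-δ) :=
    Finset.sum_le_sum fun k _ => mul_le_mul_of_nonneg_left (hg k) (hQ k)
  rw [← Finset.sum_mul] at h5
  have h6 := mul_le_mul_of_nonneg_right hεδ (Finset.sum_nonneg fun k (_ : k ∈ Finset.univ) => hQ k)
  linarith
end

section
/- Suppose r̂ takes values in [0,1], δ ∈ (0,1], there is a Slater point x^{in} with constant δ, and 0 ≤ ε ≤ δ/2. For each k ∈ {1,…,K} define Q'_k = max(Q_k + W^{(k)}_{J*} + ε, 0). If moreover Q ≠ 0 and the Euclidean norm satisfies ‖Q‖₂ ≥ 4(V + K(1+ε²))/δ, then E[ ‖Q'‖₂ ] − ‖Q‖₂ ≤ −δ/4. -/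
open MeasureTheory

/-- One-step negative drift of the Euclidean norm of the dual variables when the norm is
large: if `‖Q‖₂ ≥ 4(V + K(1+ε²))/δ` and `Q ≠ 0`, then `E[‖Q'‖₂] − ‖Q‖₂ ≤ −δ/4`. -/
theorem stmt_5
    {C : Type*} [Countable C] [MeasurableSpace C] [MeasurableSingletonClass C]
    {J K : ℕ} (hJ : 1 ≤ J) (hK : 1 ≤ K)
    (p : C → ℝ) (hp0 : ∀ c, 0 ≤ p c) (hp1 : ∀ c, p c ≤ 1) (hpsum : ∑' c, p c = 1)
    (w : Fin K → C → Fin J → ℝ) (hw : ∀ k c j, w k c j ∈ Set.Icc (-1 : ℝ) 1)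
    (δ : ℝ) (hδ : δ ∈ Set.Ioc (0 : ℝ) 1)
    (xin : C → Fin J → ℝ)
    (hin0 : ∀ c j, 0 ≤ xin c j) (hin1 : ∀ c, ∑ j, xin c j = 1)
    (hinslater : ∀ k, (∑' c, ∑ j, p c * w k c j * xin c j) ≤ -δ)
    {Ω : Type*} [MeasurableSpace Ω] (P : Measure Ω) [IsProbabilityMeasure P]
    (c : Ω → C) (hc : Measurable c)
    (hlaw : ∀ c₀, (P {ω | c ω = c₀}).toReal = p c₀)
    (W : Fin K → Fin J → Ω → ℝ)
    (hWmeas : ∀ k j, Measurable (W k j))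
    (hWbd : ∀ k j ω, |W k j ω| ≤ 1)
    (hWlaw : ∀ k j c₀, ∫ ω in {ω | c ω = c₀}, W k j ω ∂P = p c₀ * w k c₀ j)
    (Q : Fin K → ℝ) (hQ : ∀ k, 0 ≤ Q k)
    (V : ℝ) (hV : 0 ≤ V)
    (rhat : C → Fin J → ℝ) (hrhat : ∀ c₀ j, rhat c₀ j ∈ Set.Icc (0 : ℝ) 1)
    (Jstar : Ω → Fin J) (hJstarMeas : Measurable Jstar)
    (hJstarOpt : ∀ᵐ ω ∂P, ∀ j : Fin J,
      V * rhat (c ω) j - ∑ k, Q k * W k j ω ≤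
        V * rhat (c ω) (Jstar ω) - ∑ k, Q k * W k (Jstar ω) ω)
    (ε : ℝ) (hε0 : 0 ≤ ε) (hεδ : ε ≤ δ / 2)
    (Q' : Fin K → Ω → ℝ)
    (hQ' : ∀ k ω, Q' k ω = max (Q k + W k (Jstar ω) ω + ε) 0)
    (hQne : Q ≠ 0)
    (hQbig : 4 * (V + K * (1 + ε ^ 2)) / δ ≤ Real.sqrt (∑ k, (Q k) ^ 2)) :
    ∫ ω, Real.sqrt (∑ k, (Q' k ω) ^ 2) ∂P - Real.sqrt (∑ k, (Q k) ^ 2) ≤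
      -(δ / 4) := by
  classical
  obtain ⟨hδ0, hδ1⟩ := hδ
  set S := Real.sqrt (∑ k, (Q k) ^ 2) with hS
  have hsq0 : 0 ≤ ∑ k, (Q k) ^ 2 := Finset.sum_nonneg fun k _ => sq_nonneg _
  have hSS : S ^ 2 = ∑ k, (Q k) ^ 2 := Real.sq_sqrt hsq0
  have hSpos : 0 < S := by
    apply Real.sqrt_pos.mpr
    obtain ⟨k, hk⟩ := Function.ne_iff.mp hQne
    refine Finset.sum_pos' (fun k _ => sq_nonneg _) ⟨k, Finset.mem_univ _, ?_⟩
    have : Q k ≠ 0 := hk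
    positivity
  have hsum0 : 0 ≤ ∑ k, Q k := Finset.sum_nonneg fun k _ => hQ k
  have hSsum : S ≤ ∑ k, Q k := by
    apply Real.sqrt_le_iff.mpr
    exact ⟨hsum0, Finset.sum_sq_le_sq_sum_of_nonneg fun k _ => hQ k⟩
  have hxle : ∀ c j, xin c j ≤ 1 := fun c j => by
    rw [← hin1 c]
    exact Finset.single_le_sum (fun j _ => hin0 c j) (Finset.mem_univ j)
  have hxm : ∀ j, Measurable fun ω => xin (c ω) j := fun j =>
    (measurable_of_countable (fun a => xin a j)).comp hc
  have hint1 : ∀ k j, Integrable (fun ω => xin (c ω) j * W k j ω) P := fun k j => by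
    refine Integrable.of_bound ((hxm j).mul (hWmeas k j)).aestronglyMeasurable 1
      (Filter.Eventually.of_forall fun ω => ?_)
    rw [Real.norm_eq_abs, abs_mul, abs_of_nonneg (hin0 _ _)]
    exact mul_le_one₀ (hxle _ _) (abs_nonneg _) (hWbd _ _ _)
  have hintk : ∀ k, Integrable (fun ω => ∑ j, xin (c ω) j * W k j ω) P := fun k =>
    integrable_finsetSum _ fun j _ => hint1 k j
  have hmain : ∀ k, ∫ ω, ∑ j, xin (c ω) j * W k j ω ∂P ≤ -δ := fun k => by
    refine le_trans (le_of_eq ?_) (hinslater k)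
    have hm : ∀ a, MeasurableSet {ω | c ω = a} := fun a => hc (measurableSet_singleton a)
    have hU : (⋃ a, {ω | c ω = a}) = Set.univ := by
      ext ω; simp
    have h := integral_iUnion (μ := P) (f := fun ω => ∑ j, xin (c ω) j * W k j ω) hm
      (by
        intro a b hab
        refine Set.disjoint_left.mpr fun ω h1 h2 => hab ?_
        exact h1.symm.trans h2) (hintk k).integrableOn
    rw [hU, setIntegral_univ] at h
    rw [h]
    congr 1
    ext a
    rw [integral_finsetSum _ fun j _ => (hint1 k j).integrableOn]
    refine Finset.sum_congr rfl fun j _ => ?_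
    rw [← hWlaw k j a, mul_comm, ← integral_const_mul]
    refine setIntegral_congr_fun (hm a) fun ω hω => ?_
    have : c ω = a := hω
    simp only [this]
  have hintQ : Integrable (fun ω => ∑ k, Q k * ∑ j, xin (c ω) j * W k j ω) P :=
    integrable_finsetSum _ fun k _ => (hintk k).const_mul _
  have hEQ : ∫ ω, ∑ k, Q k * ∑ j, xin (c ω) j * W k j ω ∂P ≤ -δ * ∑ k, Q k := by
    rw [integral_finsetSum _ fun k _ => (hintk k).const_mul _, Finset.mul_sum]
    refine Finset.sum_le_sum fun k _ => ?_
    rw [integral_const_mul, mul_comm (-δ)]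
    exact mul_le_mul_of_nonneg_left (hmain k) (hQ k)
  set B := S + (V + ε * ∑ k, Q k + K * (1 + ε ^ 2)) / S with hB
  have hpt : ∀ᵐ ω ∂P, Real.sqrt (∑ k, (Q' k ω) ^ 2) ≤
      B + (∑ k, Q k * ∑ j, xin (c ω) j * W k j ω) / S := by
    filter_upwards [hJstarOpt] with ω hω
    have h1 : ∀ j, ∑ k, Q k * W k (Jstar ω) ω ≤ V + ∑ k, Q k * W k j ω := fun j => by
      have a1 := mul_nonneg hV (hrhat (c ω) j).1
      have a2 := mul_le_mul_of_nonneg_left (hrhat (c ω) (Jstar ω)).2 hV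
      linarith [hω j]
    have h2 : ∑ k, Q k * W k (Jstar ω) ω ≤ V + ∑ k, Q k * ∑ j, xin (c ω) j * W k j ω := by
      have e1 : ∑ j, xin (c ω) j * (∑ k, Q k * W k (Jstar ω) ω) ≤
          ∑ j, xin (c ω) j * (V + ∑ k, Q k * W k j ω) :=
        Finset.sum_le_sum fun j _ => mul_le_mul_of_nonneg_left (h1 j) (hin0 _ _)
      rw [← Finset.sum_mul, hin1, one_mul] at e1
      refine e1.trans (le_of_eq ?_)
      simp only [mul_add, Finset.sum_add_distrib]
      rw [← Finset.sum_mul, hin1, one_mul]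
      congr 1
      simp only [Finset.mul_sum]
      rw [Finset.sum_comm]
      refine Finset.sum_congr rfl fun k _ => Finset.sum_congr rfl fun j _ => by ring
    have h3 : ∑ k, (Q' k ω) ^ 2 ≤
        S ^ 2 + 2 * (∑ k, Q k * W k (Jstar ω) ω + ε * ∑ k, Q k + K * (1 + ε ^ 2)) := by
      have : ∀ k, (Q' k ω) ^ 2 ≤
          Q k ^ 2 + 2 * (Q k * W k (Jstar ω) ω + ε * Q k + (1 + ε ^ 2)) := fun k => by
        have b1 : (Q' k ω) ^ 2 ≤ (Q k + W k (Jstar ω) ω + ε) ^ 2 := by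
          rw [hQ']
          rcases le_total (Q k + W k (Jstar ω) ω + ε) 0 with h | h
          · rw [max_eq_right h]; nlinarith [sq_nonneg (Q k + W k (Jstar ω) ω + ε)]
          · rw [max_eq_left h]
        have b2 : (W k (Jstar ω) ω) ^ 2 ≤ 1 := (sq_le_one_iff_abs_le_one _).mpr (hWbd _ _ _)
        nlinarith [sq_nonneg (W k (Jstar ω) ω - ε)]
      refine (Finset.sum_le_sum fun k _ => this k).trans (le_of_eq ?_)
      rw [Finset.sum_add_distrib, ← Finset.mul_sum, Finset.sum_add_distrib,
        Finset.sum_add_distrib, ← Finset.mul_sum, hSS]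
      simp
      ring
    have h4 : 0 ≤ ∑ k, (Q' k ω) ^ 2 := Finset.sum_nonneg fun k _ => sq_nonneg _
    have h5 := Real.sq_sqrt h4
    set y := Real.sqrt (∑ k, (Q' k ω) ^ 2)
    rw [hB, add_assoc, ← add_div, ← sub_le_iff_le_add', le_div_iff₀ hSpos]
    nlinarith [sq_nonneg (y - S)]
  have hI : ∫ ω, Real.sqrt (∑ k, (Q' k ω) ^ 2) ∂P ≤
      ∫ ω, (B + (∑ k, Q k * ∑ j, xin (c ω) j * W k j ω) / S) ∂P :=
    integral_mono_of_nonneg (Filter.Eventually.of_forall fun ω => Real.sqrt_nonneg _)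
      ((integrable_const B).add (hintQ.div_const S)) hpt
  rw [integral_add (integrable_const B) (hintQ.div_const S), integral_div] at hI
  simp only [integral_const, probReal_univ, one_smul] at hI
  rw [div_le_iff₀ hδ0] at hQbig
  have hfin : (V + ε * ∑ k, Q k + K * (1 + ε ^ 2)) / S +
      (∫ ω, ∑ k, Q k * ∑ j, xin (c ω) j * W k j ω ∂P) / S ≤ -(δ / 4) := by
    rw [← add_div, div_le_iff₀ hSpos]
    nlinarith [mul_le_mul_of_nonneg_right hεδ hsum0, mul_le_mul_of_nonneg_left hSsum hδ0.le]
  linarith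
end

section
/- (Drift lemma.) Assume drift conditions (i) and (ii) hold for every t ∈ ℕ. Then for every t ∈ ℕ, E[ exp(ζ Φ(t)) ] ≤ exp(ζ Φ₀) + (2/(ζ ρ)) · exp(ζ (ν_max + φ_t)), where ζ = ρ/(ν_max² + ν_max ρ / 3). -/
open MeasureTheory

lemma drift_exp_bound (x c : ℝ) (hc : c ≤ 3 / 4) (hx : |x| ≤ c) :
    Real.exp x ≤ 1 + x + c ^ 2 / 2 / (1 - c / 3) := by
  have hx0 := abs_nonneg x
  have h := (abs_le.1 (Real.exp_bound (x := x) (by linarith) (n := 4) (by norm_num))).2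
  simp [Finset.sum_range_succ, Nat.factorial] at h
  have h3 : x ^ 3 ≤ c ^ 3 := by
    calc x ^ 3 ≤ |x ^ 3| := le_abs_self _
      _ = |x| ^ 3 := abs_pow _ _
      _ ≤ c ^ 3 := by gcongr
  have h2 : x ^ 2 ≤ c ^ 2 := by
    rw [← sq_abs]; gcongr
  have h4 : x ^ 4 ≤ c ^ 4 := by
    have : x ^ 4 = (x ^ 2) ^ 2 := by ring
    rw [this]
    have : c ^ 4 = (c ^ 2) ^ 2 := by ring
    rw [this]; gcongr
  have h5 : c ^ 2 / 2 * (1 + c / 3 + c ^ 2 / 9) ≤ c ^ 2 / 2 / (1 - c / 3) := by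
    rw [le_div_iff₀ (by linarith)]
    have : 0 ≤ c ^ 5 := by have : 0 ≤ c := by linarith
                           positivity
    nlinarith
  have h6 : 0 ≤ c ^ 4 := by positivity
  norm_num at h
  have h7 : |x| ^ 4 = x ^ 4 := by rw [← abs_pow, abs_of_nonneg (by positivity)]
  rw [h7] at h
  linarith

lemma drift_step
    {Ω : Type*} (m : MeasurableSpace Ω) {m0 : MeasurableSpace Ω} (P : Measure Ω)
    [IsProbabilityMeasure P] (hm : m ≤ m0) (X Z : Ω → ℝ) (hX : Measurable[m] X)
    (hZ : Measurable Z) (K : ℝ) (hK : ∀ᵐ ω ∂P, |X ω| ≤ K)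
    (ρ ν φ : ℝ) (hρ : 0 < ρ) (hρν : ρ ≤ ν)
    (ζ : ℝ) (hζ : ζ = ρ / (ν ^ 2 + ν * ρ / 3))
    (hdrift : ∀ᵐ ω ∂P, φ ≤ X ω → (P[fun ω' => Z ω' - X ω' | m]) ω ≤ -ρ)
    (hbdd : ∀ᵐ ω ∂P, |Z ω - X ω| ≤ ν) :
    ∫ ω, Real.exp (ζ * Z ω) ∂P ≤
      (1 - ζ * ρ / 2) * ∫ ω, Real.exp (ζ * X ω) ∂P + Real.exp (ζ * (ν + φ)) := by
  have hν : 0 < ν := by linarith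
  have hζ0 : 0 < ζ := by rw [hζ]; positivity
  have hc : ζ * ν ≤ 3 / 4 := by
    rw [hζ, div_mul_eq_mul_div, div_le_iff₀ (by positivity)]; nlinarith
  have hc2 : (ζ * ν) ^ 2 / 2 / (1 - ζ * ν / 3) = ζ * ρ / 2 := by
    have : 0 < 1 - ζ * ν / 3 := by linarith
    have h2 : ζ * (ν ^ 2 + ν * ρ / 3) = ρ := by rw [hζ]; field_simp
    rw [div_eq_iff this.ne']
    linear_combination ζ / 2 * h2
  have hX0 : Measurable X := hX.mono hm le_rfl
  let Y : Ω → ℝ := {ω | φ ≤ X ω}.indicator (fun ω => Real.exp (ζ * X ω))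
  have hS : MeasurableSet[m] {ω | φ ≤ X ω} := by
    exact hX measurableSet_Ici
  have hYm : Measurable[m] Y := by
    have : Measurable[m] (fun ω => Real.exp (ζ * X ω)) :=
      Real.measurable_exp.comp (hX.const_mul ζ)
    exact this.indicator hS
  have hY0 : ∀ ω, 0 ≤ Y ω := fun ω => Set.indicator_nonneg (fun _ _ => (Real.exp_pos _).le) _
  have hYle : ∀ ω, Y ω ≤ Real.exp (ζ * X ω) := fun ω =>
    Set.indicator_le_self' (fun _ _ => (Real.exp_pos _).le) _
  have heX : ∀ᵐ ω ∂P, Real.exp (ζ * X ω) ≤ Real.exp (ζ * K) := by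
    filter_upwards [hK] with ω h
    have := (abs_le.1 h).2
    gcongr
  have hiX : Integrable (fun ω => Real.exp (ζ * X ω)) P := by
    refine Integrable.of_bound (Measurable.aestronglyMeasurable (by fun_prop)) (Real.exp (ζ * K)) ?_
    filter_upwards [heX] with ω h
    rwa [Real.norm_eq_abs, abs_of_pos (Real.exp_pos _)]
  have hYm0 : Measurable Y := hYm.mono hm le_rfl
  have hiY : Integrable Y P := by
    refine hiX.mono' hYm0.aestronglyMeasurable (.of_forall fun ω => ?_)
    rw [Real.norm_eq_abs, abs_of_nonneg (hY0 ω)]; exact hYle ω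
  have hiD : Integrable (fun ω => Z ω - X ω) P :=
    Integrable.of_bound (hZ.sub hX0).aestronglyMeasurable ν (by simpa using hbdd)
  have hiYD : Integrable (Y * fun ω => Z ω - X ω) P := by
    have := hiY.mul_bdd (c := ν) (hZ.sub hX0).aestronglyMeasurable (by simpa using hbdd)
    exact this
  have hpull := condExp_mul_of_stronglyMeasurable_left (μ := P) (m := m)
    hYm.stronglyMeasurable hiYD hiD
  have hkey : ∫ ω, Y ω * (Z ω - X ω) ∂P ≤ -ρ * ∫ ω, Y ω ∂P := by
    calc ∫ ω, Y ω * (Z ω - X ω) ∂P = ∫ ω, (P[Y * fun ω => Z ω - X ω | m]) ω ∂P :=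
          (integral_condExp hm).symm
      _ ≤ ∫ ω, -ρ * Y ω ∂P := by
          refine integral_mono_ae integrable_condExp (hiY.const_mul _) ?_
          filter_upwards [hpull, hdrift] with ω h1 h2
          rw [h1]
          by_cases h : φ ≤ X ω
          · have := mul_le_mul_of_nonneg_left (h2 h) (hY0 ω)
            simp only [Pi.mul_apply]
            linarith
          · have : Y ω = 0 := Set.indicator_of_notMem (s := {ω | φ ≤ X ω}) h _
            simp [this]
      _ = _ := integral_const_mul _ _
  have hpt : ∀ᵐ ω ∂P, Real.exp (ζ * Z ω) ≤
      (1 + ζ * ρ / 2) * Y ω + ζ * (Y ω * (Z ω - X ω)) + Real.exp (ζ * (ν + φ)) := by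
    filter_upwards [hbdd] with ω h
    by_cases hs : φ ≤ X ω
    · have hYe : Y ω = Real.exp (ζ * X ω) := Set.indicator_of_mem (s := {ω | φ ≤ X ω}) hs _
      have hb := drift_exp_bound (ζ * (Z ω - X ω)) (ζ * ν) hc (by
        rw [abs_mul, abs_of_pos hζ0]; gcongr)
      rw [hc2] at hb
      have he : Real.exp (ζ * Z ω) = Y ω * Real.exp (ζ * (Z ω - X ω)) := by
        rw [hYe, ← Real.exp_add]; congr 1; ring
      have := mul_le_mul_of_nonneg_left hb (hY0 ω)
      have := Real.exp_pos (ζ * (ν + φ))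
      rw [he]; linarith
    · have hYe : Y ω = 0 := Set.indicator_of_notMem (s := {ω | φ ≤ X ω}) hs _
      simp only [hYe, mul_zero, zero_mul, zero_add]
      have := (abs_le.1 h).2
      have : Z ω ≤ ν + φ := by linarith
      gcongr
  have hi1 : Integrable (fun ω => (1 + ζ * ρ / 2) * Y ω) P := hiY.const_mul _
  have hi2 : Integrable (fun ω => ζ * (Y ω * (Z ω - X ω))) P := hiYD.const_mul _
  have hi3 : Integrable (fun _ : Ω => Real.exp (ζ * (ν + φ))) P := integrable_const _
  have hint := integral_mono_of_nonneg (.of_forall fun ω => (Real.exp_pos _).le)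
    ((hi1.add hi2).add hi3) hpt
  simp only [Pi.add_apply] at hint
  rw [integral_add (by exact hi1.add hi2) hi3, integral_add hi1 hi2, integral_const_mul,
    integral_const_mul] at hint
  simp only [integral_const, probReal_univ, one_smul] at hint
  have hYX := integral_mono hiY hiX hYle
  have h1 := mul_le_mul_of_nonneg_left hkey hζ0.le
  have hδ : 0 ≤ 1 - ζ * ρ / 2 := by
    have := mul_le_mul_of_nonneg_left hρν hζ0.le
    linarith
  have h2 := mul_le_mul_of_nonneg_left hYX hδ
  linarith


/-- Drift lemma: under a negative conditional drift above the level `φ_t` and bounded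
increments, the exponential moment of the process stays bounded:
`E[exp(ζ Φ(t))] ≤ exp(ζ Φ₀) + (2/(ζρ)) exp(ζ(ν_max + φ_t))` with
`ζ = ρ/(ν_max² + ν_max ρ/3)`. -/
theorem stmt_6
    {Ω : Type*} {m0 : MeasurableSpace Ω} (P : Measure Ω) [IsProbabilityMeasure P]
    (𝓕 : Filtration ℕ m0)
    (Φ : ℕ → Ω → ℝ) (hadapted : Adapted 𝓕 Φ)
    (Φ₀ : ℝ) (hΦ₀ : ∀ᵐ ω ∂P, Φ 0 ω = Φ₀)
    (ρ ν : ℝ) (hρ : 0 < ρ) (hρν : ρ ≤ ν)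
    (ϕ : ℕ → ℝ) (hϕpos : ∀ t, 0 < ϕ t) (hϕmono : Monotone ϕ)
    (ζ : ℝ) (hζ : ζ = ρ / (ν ^ 2 + ν * ρ / 3))
    (hdrift : ∀ t, ∀ᵐ ω ∂P, ϕ t ≤ Φ t ω →
      (P[fun ω' => Φ (t + 1) ω' - Φ t ω' | 𝓕 t]) ω ≤ -ρ)
    (hbdd : ∀ t, ∀ᵐ ω ∂P, |Φ (t + 1) ω - Φ t ω| ≤ ν) :
    ∀ t, ∫ ω, Real.exp (ζ * Φ t ω) ∂P ≤
      Real.exp (ζ * Φ₀) + (2 / (ζ * ρ)) * Real.exp (ζ * (ν + ϕ t)) := by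
  have hmeas : ∀ t, Measurable (Φ t) := fun t => (hadapted t).mono (𝓕.le t) le_rfl
  have hK : ∀ t : ℕ, ∀ᵐ ω ∂P, |Φ t ω| ≤ |Φ₀| + t * ν := by
    intro t
    induction t with
    | zero => filter_upwards [hΦ₀] with ω h; simp [h]
    | succ t ih =>
      filter_upwards [ih, hbdd t] with ω h1 h2
      have := abs_add_le (Φ t ω) (Φ (t + 1) ω - Φ t ω)
      rw [add_sub_cancel] at this
      push_cast
      linarith
  have hν : 0 < ν := by linarith
  have hζ0 : 0 < ζ := by rw [hζ]; positivity
  intro t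
  induction t with
  | zero =>
    have : ∫ ω, Real.exp (ζ * Φ 0 ω) ∂P = Real.exp (ζ * Φ₀) := by
      rw [integral_congr_ae (g := fun _ => Real.exp (ζ * Φ₀))]
      · simp
      · filter_upwards [hΦ₀] with ω h; rw [h]
    rw [this]
    have : 0 < (2 / (ζ * ρ)) * Real.exp (ζ * (ν + ϕ 0)) := by positivity
    linarith
  | succ t ih =>
    have hs := drift_step (𝓕 t) P (𝓕.le t) (Φ t) (Φ (t + 1)) (hadapted t) (hmeas _) _ (hK t)
      ρ ν (ϕ t) hρ hρν ζ hζ (hdrift t) (hbdd t)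
    have hδ : 0 ≤ 1 - ζ * ρ / 2 := by
      have : ζ * ρ ≤ 1 := by
        rw [hζ, div_mul_eq_mul_div, div_le_iff₀ (by positivity)]; nlinarith
      linarith
    have h1 := mul_le_mul_of_nonneg_left ih hδ
    have h2 : (1 - ζ * ρ / 2) * (Real.exp (ζ * Φ₀) + (2 / (ζ * ρ)) * Real.exp (ζ * (ν + ϕ t)))
        + Real.exp (ζ * (ν + ϕ t)) = Real.exp (ζ * Φ₀) + (2 / (ζ * ρ)) * Real.exp (ζ * (ν + ϕ t))
          - ζ * ρ / 2 * Real.exp (ζ * Φ₀) := by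
      field_simp
      ring
    have h3 : 0 ≤ ζ * ρ / 2 * Real.exp (ζ * Φ₀) := by positivity
    have h4 : (2 / (ζ * ρ)) * Real.exp (ζ * (ν + ϕ t)) ≤
        (2 / (ζ * ρ)) * Real.exp (ζ * (ν + ϕ (t + 1))) := by
      have := hϕmono (Nat.le_succ t)
      gcongr
    linarith
end

section
/- (One-step recursion in the drift lemma.) Fix t ∈ ℕ and assume drift conditions (i) and (ii) hold at time t, and that Φ(t) is bounded (e.g., |Φ(t)| ≤ |Φ₀| + t·ν_max almost surely, which follows from condition (ii) holding at all earlier times). Then E[ exp(ζ Φ(t+1)) ] ≤ (1 − ζρ/2) · E[ exp(ζ Φ(t)) ] + exp(ζ (ν_max + φ_t)), where ζ = ρ/(ν_max² + ν_max ρ / 3). -/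
open MeasureTheory

lemma exp_aux (x b : ℝ) (hx : |x| ≤ b) (hb : b ≤ 1) (c : ℝ) (hc : b ^ 2 / 2 ≤ c * (1 - b / 3)) :
    Real.exp x ≤ 1 + x + c := by
  have h := (abs_le.1 (Real.exp_bound (hx.trans hb) (n := 4) (by norm_num))).2
  have hb0 : 0 ≤ b := (abs_nonneg x).trans hx
  simp only [Finset.sum_range_succ, Finset.sum_range_zero, Nat.factorial] at h
  norm_num at h
  have h2 : x ^ 2 ≤ b ^ 2 := by rw [← sq_abs]; gcongr
  have h3 : x ^ 3 ≤ b ^ 3 := by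
    calc x ^ 3 ≤ |x ^ 3| := le_abs_self _
      _ = |x| ^ 3 := abs_pow _ _
      _ ≤ b ^ 3 := by gcongr
  have h4 : |x| ^ 4 ≤ b ^ 4 := by gcongr
  have h4' : x ^ 4 ≤ b ^ 4 := by
    calc x ^ 4 ≤ |x ^ 4| := le_abs_self _
      _ = |x| ^ 4 := abs_pow _ _
      _ ≤ b ^ 4 := h4
  have h5 : 0 ≤ b ^ 4 := by positivity
  have h6 : b ^ 2 / 2 + b ^ 3 / 6 + b ^ 4 * (5 / 96) ≤ c := by
    have hpos : 0 < 1 - b / 3 := by linarith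
    have : (b ^ 2 / 2 + b ^ 3 / 6 + b ^ 4 * (5 / 96)) * (1 - b / 3) ≤ c * (1 - b / 3) := by
      refine le_trans ?_ hc
      have h7 : 0 ≤ b ^ 5 := by positivity
      nlinarith
    exact le_of_mul_le_mul_right this hpos
  linarith

/-- One-step recursion in the drift lemma: if drift conditions (i) and (ii) hold at time
`t` and `Φ(t)` is bounded, then
`E[exp(ζ Φ(t+1))] ≤ (1 − ζρ/2) E[exp(ζ Φ(t))] + exp(ζ(ν_max + φ_t))` with
`ζ = ρ/(ν_max² + ν_max ρ/3)`. -/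
theorem stmt_7
    {Ω : Type*} {m0 : MeasurableSpace Ω} (P : Measure Ω) [IsProbabilityMeasure P]
    (𝓕 : Filtration ℕ m0)
    (Φ : ℕ → Ω → ℝ) (hadapted : Adapted 𝓕 Φ)
    (Φ₀ : ℝ) (hΦ₀ : ∀ᵐ ω ∂P, Φ 0 ω = Φ₀)
    (ρ ν : ℝ) (hρ : 0 < ρ) (hρν : ρ ≤ ν)
    (ϕ : ℕ → ℝ) (hϕpos : ∀ t, 0 < ϕ t) (hϕmono : Monotone ϕ)
    (ζ : ℝ) (hζ : ζ = ρ / (ν ^ 2 + ν * ρ / 3))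
    (t : ℕ)
    (hdrift : ∀ᵐ ω ∂P, ϕ t ≤ Φ t ω →
      (P[fun ω' => Φ (t + 1) ω' - Φ t ω' | 𝓕 t]) ω ≤ -ρ)
    (hbdd : ∀ᵐ ω ∂P, |Φ (t + 1) ω - Φ t ω| ≤ ν)
    (hΦbdd : ∀ᵐ ω ∂P, |Φ t ω| ≤ |Φ₀| + t * ν) :
    ∫ ω, Real.exp (ζ * Φ (t + 1) ω) ∂P ≤
      (1 - ζ * ρ / 2) * ∫ ω, Real.exp (ζ * Φ t ω) ∂P
        + Real.exp (ζ * (ν + ϕ t)) := by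
  have hν : 0 < ν := hρ.trans_le hρν
  have hden : 0 < ν ^ 2 + ν * ρ / 3 := by positivity
  have hζ0 : 0 < ζ := by rw [hζ]; positivity
  have hζe : ζ * (ν ^ 2 + ν * ρ / 3) = ρ := by rw [hζ]; field_simp
  have hζν : ζ * ν ≤ 1 := by
    have h1 : ζ * ν * (ν + ρ / 3) = ρ := by linarith
    by_contra hcon
    have : 1 * (ν + ρ / 3) < ζ * ν * (ν + ρ / 3) :=
      mul_lt_mul_of_pos_right (not_le.1 hcon) (by positivity)
    linarith
  have hζρ : ζ * ρ ≤ 1 := (mul_le_mul_of_nonneg_left hρν hζ0.le).trans hζν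
  have hc : (ζ * ν) ^ 2 / 2 ≤ (ζ * ρ / 2) * (1 - (ζ * ν) / 3) := by
    have : ζ * (ζ * (ν ^ 2 + ν * ρ / 3)) = ζ * ρ := by rw [hζe]
    linarith
  have hm : 𝓕 t ≤ m0 := 𝓕.le t
  have hmt : Measurable[𝓕 t] (Φ t) := hadapted t
  have hmt0 : Measurable (Φ t) := hmt.mono hm le_rfl
  have hmt1 : Measurable (Φ (t + 1)) := (hadapted (t + 1)).mono (𝓕.le _) le_rfl
  set D : Ω → ℝ := fun ω => Φ (t + 1) ω - Φ t ω with hD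
  have hDm : Measurable D := hmt1.sub hmt0
  have hDi : Integrable D P := Integrable.of_bound hDm.aestronglyMeasurable ν (by simpa using hbdd)
  set K : ℝ := |Φ₀| + t * ν with hK
  set f : Ω → ℝ := fun ω => Real.exp (ζ * Φ t ω) with hf
  have hfm : Measurable[𝓕 t] f := (hmt.const_mul ζ).exp
  have hfm0 : Measurable f := hfm.mono hm le_rfl
  have hfb : ∀ᵐ ω ∂P, ‖f ω‖ ≤ Real.exp (ζ * K) := by
    filter_upwards [hΦbdd] with ω h
    rw [Real.norm_eq_abs, abs_of_pos (Real.exp_pos _)]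
    exact Real.exp_le_exp.2 (mul_le_mul_of_nonneg_left ((le_abs_self _).trans h) hζ0.le)
  have hfi : Integrable f P := Integrable.of_bound hfm0.aestronglyMeasurable _ hfb
  have hA : MeasurableSet[𝓕 t] {ω | ϕ t ≤ Φ t ω} := hmt measurableSet_Ici
  set g : Ω → ℝ := Set.indicator {ω | ϕ t ≤ Φ t ω} f with hg
  have hgm : Measurable[𝓕 t] g := hfm.indicator hA
  have hgm0 : Measurable g := hgm.mono hm le_rfl
  have hgb : ∀ᵐ ω ∂P, ‖g ω‖ ≤ Real.exp (ζ * K) := by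
    filter_upwards [hfb] with ω h
    exact (norm_indicator_le_norm_self _ _).trans h
  have hgi : Integrable g P := Integrable.of_bound hgm0.aestronglyMeasurable _ hgb
  have hgDi : Integrable (g * D) P := hDi.bdd_mul hgm0.aestronglyMeasurable hgb
  have hkey : ∫ ω, (g * D) ω ∂P ≤ ∫ ω, -ρ * g ω ∂P := by
    rw [← integral_condExp hm]
    refine integral_mono_ae integrable_condExp (hgi.const_mul _) ?_
    filter_upwards [condExp_mul_of_stronglyMeasurable_left hgm.stronglyMeasurable hgDi hDi,
      hdrift] with ω h1 h2
    rw [h1, Pi.mul_apply]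
    by_cases hω : ϕ t ≤ Φ t ω
    · have : 0 ≤ g ω := Set.indicator_nonneg (fun _ _ => (Real.exp_pos _).le) _
      have := mul_le_mul_of_nonneg_left (h2 hω) this
      linarith
    · have : g ω = 0 := by simp [hg, hω]
      simp [this]
  have hf1i : Integrable (fun ω => Real.exp (ζ * Φ (t + 1) ω)) P := by
    refine Integrable.of_bound (hmt1.const_mul ζ).exp.aestronglyMeasurable
      (Real.exp (ζ * (K + ν))) ?_
    filter_upwards [hΦbdd, hbdd] with ω h h'
    rw [Real.norm_eq_abs, abs_of_pos (Real.exp_pos _)]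
    refine Real.exp_le_exp.2 (mul_le_mul_of_nonneg_left ?_ hζ0.le)
    have := (abs_le.1 h).2
    have := (abs_le.1 h').2
    linarith
  set C : ℝ := Real.exp (ζ * (ν + ϕ t)) with hC
  have i1 : Integrable (fun ω => (1 - ζ * ρ / 2) * f ω) P := hfi.const_mul _
  have i2 : Integrable (fun ω => ζ * ρ * g ω) P := hgi.const_mul _
  have i3 : Integrable (fun ω => ζ * (g * D) ω) P := hgDi.const_mul _
  have i4 : Integrable (fun _ : Ω => C) P := integrable_const _
  have i12 : Integrable (fun ω => (1 - ζ * ρ / 2) * f ω + ζ * ρ * g ω) P := i1.add i2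
  have i123 : Integrable (fun ω => (1 - ζ * ρ / 2) * f ω + ζ * ρ * g ω + ζ * (g * D) ω) P :=
    i12.add i3
  have hmain : ∫ ω, Real.exp (ζ * Φ (t + 1) ω) ∂P ≤
      ∫ ω, ((1 - ζ * ρ / 2) * f ω + ζ * ρ * g ω + ζ * (g * D) ω + C) ∂P := by
    refine integral_mono_ae hf1i (i123.add i4) ?_
    filter_upwards [hbdd] with ω h
    have hfp : 0 < f ω := Real.exp_pos _
    have hCp : 0 < C := Real.exp_pos _
    by_cases hω : ϕ t ≤ Φ t ω
    · have hgω : g ω = f ω := by simp [hg, hω]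
      have hx : |ζ * D ω| ≤ ζ * ν := by
        rw [abs_mul, abs_of_pos hζ0]
        exact mul_le_mul_of_nonneg_left h hζ0.le
      have h1 := mul_le_mul_of_nonneg_left (exp_aux _ _ hx hζν _ hc) hfp.le
      have h2 : Real.exp (ζ * Φ (t + 1) ω) = f ω * Real.exp (ζ * D ω) := by
        rw [hf, ← Real.exp_add]; congr 1; simp only [hD]; ring
      rw [← h2] at h1
      simp only [Pi.mul_apply, hgω]
      linarith
    · have hgω : g ω = 0 := by simp [hg, hω]
      have h1 : Real.exp (ζ * Φ (t + 1) ω) ≤ C := by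
        refine Real.exp_le_exp.2 (mul_le_mul_of_nonneg_left ?_ hζ0.le)
        have := (abs_le.1 h).2
        have := not_le.1 hω
        linarith
      simp only [Pi.mul_apply, hgω]
      have : 0 ≤ (1 - ζ * ρ / 2) * f ω := mul_nonneg (by linarith) hfp.le
      linarith
  have hsplit : ∫ ω, ((1 - ζ * ρ / 2) * f ω + ζ * ρ * g ω + ζ * (g * D) ω + C) ∂P =
      (1 - ζ * ρ / 2) * ∫ ω, f ω ∂P + ζ * ρ * ∫ ω, g ω ∂P + ζ * ∫ ω, (g * D) ω ∂P + C := by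
    rw [integral_add i123 i4, integral_add i12 i3, integral_add i1 i2,
      integral_const_mul, integral_const_mul, integral_const_mul]
    simp
  rw [integral_const_mul] at hkey
  have := mul_le_mul_of_nonneg_left hkey hζ0.le
  linarith
end

section
/- Let ν > 0, ζ ≥ 0 with ζν < 3, and let x be a real number with |x| ≤ ν. Then exp(ζ x) ≤ 1 + ζ x + (ζ ν)² / (2 (1 − ζ ν / 3)). -/
/-- Exponential bound: for `|x| ≤ ν`, `ζ ≥ 0`, `ζν < 3`,
`exp(ζx) ≤ 1 + ζx + (ζν)²/(2(1 − ζν/3))`. -/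
theorem stmt_8 (ν ζ x : ℝ) (hν : 0 < ν) (hζ : 0 ≤ ζ) (hζν : ζ * ν < 3)
    (hx : |x| ≤ ν) :
    Real.exp (ζ * x) ≤ 1 + ζ * x + (ζ * ν) ^ 2 / (2 * (1 - ζ * ν / 3)) := by
  have hy : |ζ * x| ≤ ζ * ν := by
    rw [abs_mul, abs_of_nonneg hζ]
    exact mul_le_mul_of_nonneg_left hx hζ
  have ht : 0 ≤ ζ * ν := mul_nonneg hζ hν.le
  generalize ζ * x = y at *
  generalize ζ * ν = t at *
  have h1 : HasSum (fun n : ℕ => y ^ n / (n.factorial : ℝ)) (Real.exp y) := by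
    rw [Real.exp_eq_exp_ℝ]
    exact NormedSpace.expSeries_div_hasSum_exp y
  have h2 := (hasSum_nat_add_iff' 2).mpr h1
  have h3 : HasSum (fun n : ℕ => t ^ 2 / 2 * (t / 3) ^ n) (t ^ 2 / 2 * (1 - t / 3)⁻¹) :=
    (hasSum_geometric_of_lt_one (by positivity) (by linarith)).mul_left _
  have h4 := hasSum_le (fun n => ?_) h2 h3
  · have h5 : t ^ 2 / (2 * (1 - t / 3)) = t ^ 2 / 2 * (1 - t / 3)⁻¹ := by
      rw [← div_div, div_eq_mul_inv _ (1 - t / 3)]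
    rw [h5]
    simp [Finset.sum_range_succ] at h4
    linarith
  · have h6 : (2 : ℝ) * 3 ^ n ≤ ((n + 2).factorial : ℝ) := by
      have := @Nat.factorial_mul_pow_le_factorial 2 n
      rw [add_comm 2 n] at this
      exact_mod_cast this
    have h7 : y ^ (n + 2) ≤ t ^ (n + 2) :=
      (le_abs_self _).trans (by rw [abs_pow]; exact pow_le_pow_left₀ (abs_nonneg _) hy _)
    calc y ^ (n + 2) / ((n + 2).factorial : ℝ) ≤ t ^ (n + 2) / ((n + 2).factorial : ℝ) := by
          gcongr
      _ ≤ t ^ (n + 2) / (2 * 3 ^ n) := by gcongr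
      _ = t ^ 2 / 2 * (t / 3) ^ n := by rw [div_pow, pow_add]; field_simp
end

section
/- (Tail bound from the drift lemma.) Assume drift conditions (i) and (ii) hold for every t ∈ ℕ. Then for every t ∈ ℕ and every real a, P( Φ(t) ≥ a ) ≤ ( exp(ζ Φ₀) + (2/(ζ ρ)) · exp(ζ (ν_max + φ_t)) ) · exp(−ζ a), where ζ = ρ/(ν_max² + ν_max ρ / 3). -/
open MeasureTheory

lemma aux_exp (ρ ν ζ : ℝ) (hρ : 0 < ρ) (hρν : ρ ≤ ν) (hζ : ζ = ρ / (ν ^ 2 + ν * ρ / 3))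
    (x : ℝ) (hx : |x| ≤ ν) : Real.exp (ζ * x) ≤ 1 + ζ * x + ζ * ρ / 2 := by
  have hν : 0 < ν := by linarith
  have hden : 0 < ν ^ 2 + ν * ρ / 3 := by positivity
  have hζ0 : 0 < ζ := by rw [hζ]; positivity
  have e1 : ζ * (ν ^ 2 + ν * ρ / 3) = ρ := by rw [hζ]; field_simp
  obtain ⟨s, hs⟩ : ∃ s, s = ζ * ν := ⟨_, rfl⟩
  have hs0 : 0 < s := by rw [hs]; positivity
  have e2 : s * (ν + ρ / 3) = ρ := by rw [hs]; linarith
  have hs1 : s ≤ 1 := by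
    by_contra h
    push Not at h
    nlinarith
  -- ζρ (1 - s/3) = s²
  have e3 : ζ * ρ * (1 - s / 3) = s ^ 2 := by
    have : ρ * (1 - s / 3) = s * ν := by linarith
    rw [mul_assoc, this, hs]; ring
  have hy : |ζ * x| ≤ s := by
    rw [abs_mul, abs_of_pos hζ0, hs]; gcongr
  set y := ζ * x with hyd
  have hb := Real.exp_bound (x := y) (hy.trans hs1) (n := 4) (by norm_num)
  norm_num [Finset.sum_range_succ, Nat.factorial] at hb
  have hb' := (abs_le.1 hb).2
  set z := |y| with hz
  have hz0 : 0 ≤ z := abs_nonneg y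
  have h2 : y ^ 2 = z ^ 2 := (sq_abs y).symm
  have h3 : y ^ 3 ≤ z ^ 3 := by
    rw [hz, ← abs_pow]; exact le_abs_self _
  have h4 : z ^ 2 ≤ s ^ 2 := by gcongr
  have h5 : z ^ 3 ≤ s ^ 3 := by gcongr
  have h6 : z ^ 4 ≤ s ^ 4 := by gcongr
  have h7 : s ^ 2 + s ^ 3 / 3 + s ^ 4 / 9 ≤ ζ * ρ := by
    have hp : 0 < 1 - s / 3 := by linarith
    refine le_of_mul_le_mul_right ?_ hp
    rw [e3]
    have : 0 ≤ s ^ 5 := by positivity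
    nlinarith
  have h8 : 0 ≤ s ^ 4 := by positivity
  linarith

lemma aux_int_s9 {Ω : Type*} {m0 : MeasurableSpace Ω} (P : Measure Ω) [IsProbabilityMeasure P]
    (f : Ω → ℝ) (hf : Measurable f) (B ζ : ℝ) (hζ : 0 < ζ) (h : ∀ᵐ ω ∂P, |f ω| ≤ B) :
    Integrable (fun ω => Real.exp (ζ * f ω)) P := by
  refine Integrable.of_bound (by fun_prop) (Real.exp (ζ * B)) ?_
  filter_upwards [h] with ω hω
  rw [Real.norm_eq_abs, abs_of_pos (Real.exp_pos _)]
  have := (abs_le.1 hω).2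
  gcongr

lemma aux_step {Ω : Type*} (m : MeasurableSpace Ω) {m0 : MeasurableSpace Ω} (P : Measure Ω) [IsProbabilityMeasure P]
    (hm : m ≤ m0) (f g : Ω → ℝ) (hf : Measurable[m] f) (hg : Measurable g)
    (B : ℝ) (hfB : ∀ᵐ ω ∂P, |f ω| ≤ B)
    (ρ ν : ℝ) (hρ : 0 < ρ) (hρν : ρ ≤ ν)
    (ϕ : ℝ)
    (ζ : ℝ) (hζ : ζ = ρ / (ν ^ 2 + ν * ρ / 3))
    (hdrift : ∀ᵐ ω ∂P, ϕ ≤ f ω → (P[fun ω' => g ω' - f ω' | m]) ω ≤ -ρ)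
    (hbdd : ∀ᵐ ω ∂P, |g ω - f ω| ≤ ν) :
    ∫ ω, Real.exp (ζ * g ω) ∂P ≤
      (1 - ζ * ρ / 2) * ∫ ω, Real.exp (ζ * f ω) ∂P + Real.exp (ζ * (ν + ϕ)) := by
  have hν : 0 < ν := by linarith
  have hζ0 : 0 < ζ := by rw [hζ]; positivity
  have hq : 0 ≤ 1 - ζ * ρ / 2 := by
    have := aux_exp ρ ν ζ hρ hρν hζ (-ρ) (by rwa [abs_neg, abs_of_pos hρ])
    have := Real.exp_pos (ζ * (-ρ))
    linarith
  have hf0 : Measurable f := hf.mono hm le_rfl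
  have hgB : ∀ᵐ ω ∂P, |g ω| ≤ B + ν := by
    filter_upwards [hfB, hbdd] with ω h1 h2
    rw [abs_le] at *
    constructor <;> linarith
  have iF := aux_int_s9 P f hf0 B ζ hζ0 hfB
  have iG := aux_int_s9 P g hg _ ζ hζ0 hgB
  set A : Set Ω := {ω | ϕ ≤ f ω} with hA
  have hAm : MeasurableSet[m] A := hf measurableSet_Ici
  set G : Ω → ℝ := A.indicator (fun ω => Real.exp (ζ * f ω)) with hG
  have hGm : Measurable[m] G := by
    refine Measurable.indicator ?_ hAm
    exact Real.measurable_exp.comp (hf.const_mul ζ)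
  have hGs : StronglyMeasurable[m] G := hGm.stronglyMeasurable
  have iGG : Integrable G P := iF.indicator (hm _ hAm)
  have hG0 : ∀ ω, 0 ≤ G ω := fun ω => Set.indicator_nonneg (fun _ _ => (Real.exp_pos _).le) ω
  have iX : Integrable (fun ω' => g ω' - f ω') P :=
    Integrable.of_bound (by fun_prop) ν (by simpa using hbdd)
  have iGX : Integrable (G * fun ω' => g ω' - f ω') P := by
    refine Integrable.mul_bdd (c := ν) iGG (by fun_prop) (by simpa using hbdd)
  have hce := condExp_mul_of_stronglyMeasurable_left (μ := P) hGs iGX iX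
  have iGE : Integrable (G * P[fun ω' => g ω' - f ω' | m]) P := integrable_condExp.congr hce
  have key : ∫ ω, G ω * (g ω - f ω) ∂P ≤ ∫ ω, -ρ * G ω ∂P := by
    have e1 : ∫ ω, G ω * (g ω - f ω) ∂P = ∫ ω, (G * P[fun ω' => g ω' - f ω' | m]) ω ∂P := by
      rw [← integral_congr_ae hce, integral_condExp hm]; rfl
    rw [e1]
    refine integral_mono_ae iGE (iGG.const_mul _) ?_
    filter_upwards [hdrift] with ω hω
    by_cases h : ω ∈ A
    · have := mul_le_mul_of_nonneg_left (hω h) (hG0 ω)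
      simp only [Pi.mul_apply]; linarith
    · simp [hG, h]
  have iGX' : Integrable (fun ω => G ω * (g ω - f ω)) P := iGX
  have pw : ∫ ω, Real.exp (ζ * g ω) ∂P ≤
      ∫ ω, ((1 + ζ * ρ / 2) * G ω + ζ * (G ω * (g ω - f ω)) + Real.exp (ζ * (ν + ϕ))) ∂P := by
    refine integral_mono_ae iG
      (((iGG.const_mul _).add (iGX'.const_mul ζ)).add (integrable_const _)) ?_
    filter_upwards [hbdd] with ω hω
    by_cases h : ω ∈ A
    · have e := aux_exp ρ ν ζ hρ hρν hζ _ hω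
      have e' : Real.exp (ζ * g ω) = Real.exp (ζ * f ω) * Real.exp (ζ * (g ω - f ω)) := by
        rw [← Real.exp_add]; ring_nf
      have := mul_le_mul_of_nonneg_left e (Real.exp_pos (ζ * f ω)).le
      have := Real.exp_pos (ζ * (ν + ϕ))
      simp only [hG, Set.indicator_of_mem h]
      linarith
    · have h' : f ω < ϕ := not_le.1 h
      have := (abs_le.1 hω).2
      simp only [hG, Set.indicator_of_notMem h, mul_zero, zero_mul, zero_add]
      gcongr
      linarith
  have iS : Integrable (fun ω => (1 + ζ * ρ / 2) * G ω + ζ * (G ω * (g ω - f ω))) P :=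
    (iGG.const_mul _).add (iGX'.const_mul ζ)
  rw [integral_add iS (integrable_const _),
    integral_add (iGG.const_mul _) (iGX'.const_mul ζ), integral_const_mul, integral_const_mul] at pw
  rw [integral_const_mul] at key
  simp only [integral_const, probReal_univ, one_smul] at pw
  have hle : ∫ ω, G ω ∂P ≤ ∫ ω, Real.exp (ζ * f ω) ∂P := by
    refine integral_mono iGG iF (fun ω => ?_)
    exact Set.indicator_le_self' (fun _ _ => (Real.exp_pos _).le) ω
  have k1 := mul_le_mul_of_nonneg_left key hζ0.le
  have k2 := mul_le_mul_of_nonneg_left hle hq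
  linarith

/-- Tail bound from the drift lemma: under drift conditions (i) and (ii),
`P(Φ(t) ≥ a) ≤ (exp(ζΦ₀) + (2/(ζρ)) exp(ζ(ν_max + φ_t))) exp(−ζ a)` with
`ζ = ρ/(ν_max² + ν_max ρ/3)`. -/
theorem stmt_9
    {Ω : Type*} {m0 : MeasurableSpace Ω} (P : Measure Ω) [IsProbabilityMeasure P]
    (𝓕 : Filtration ℕ m0)
    (Φ : ℕ → Ω → ℝ) (hadapted : Adapted 𝓕 Φ)
    (Φ₀ : ℝ) (hΦ₀ : ∀ᵐ ω ∂P, Φ 0 ω = Φ₀)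
    (ρ ν : ℝ) (hρ : 0 < ρ) (hρν : ρ ≤ ν)
    (ϕ : ℕ → ℝ) (hϕpos : ∀ t, 0 < ϕ t) (hϕmono : Monotone ϕ)
    (ζ : ℝ) (hζ : ζ = ρ / (ν ^ 2 + ν * ρ / 3))
    (hdrift : ∀ t, ∀ᵐ ω ∂P, ϕ t ≤ Φ t ω →
      (P[fun ω' => Φ (t + 1) ω' - Φ t ω' | 𝓕 t]) ω ≤ -ρ)
    (hbdd : ∀ t, ∀ᵐ ω ∂P, |Φ (t + 1) ω - Φ t ω| ≤ ν) :
    ∀ (t : ℕ) (a : ℝ),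
      (P {ω | a ≤ Φ t ω}).toReal ≤
        (Real.exp (ζ * Φ₀) + (2 / (ζ * ρ)) * Real.exp (ζ * (ν + ϕ t)))
          * Real.exp (-ζ * a) := by
  have hν : 0 < ν := by linarith
  have hζ0 : 0 < ζ := by rw [hζ]; positivity
  have hq : 0 ≤ 1 - ζ * ρ / 2 := by
    have := aux_exp ρ ν ζ hρ hρν hζ (-ρ) (by rwa [abs_neg, abs_of_pos hρ])
    have := Real.exp_pos (ζ * (-ρ))
    linarith
  have hmeas : ∀ t, Measurable (Φ t) := fun t => (hadapted t).mono (𝓕.le t) le_rfl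
  have hB : ∀ t : ℕ, ∃ B : ℝ, ∀ᵐ ω ∂P, |Φ t ω| ≤ B := by
    intro t
    induction t with
    | zero => exact ⟨|Φ₀|, by filter_upwards [hΦ₀] with ω h; rw [h]⟩
    | succ t ih =>
      obtain ⟨B, hB⟩ := ih
      refine ⟨B + ν, ?_⟩
      filter_upwards [hB, hbdd t] with ω h1 h2
      rw [abs_le] at *
      constructor <;> linarith
  have hM : ∀ t : ℕ, ∫ ω, Real.exp (ζ * Φ t ω) ∂P ≤
      Real.exp (ζ * Φ₀) + (2 / (ζ * ρ)) * Real.exp (ζ * (ν + ϕ t)) := by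
    intro t
    induction t with
    | zero =>
      have : ∫ ω, Real.exp (ζ * Φ 0 ω) ∂P = ∫ _, Real.exp (ζ * Φ₀) ∂P :=
        integral_congr_ae (by filter_upwards [hΦ₀] with ω h; rw [h])
      rw [this]
      simp only [integral_const, probReal_univ, one_smul]
      have : 0 ≤ (2 / (ζ * ρ)) * Real.exp (ζ * (ν + ϕ 0)) := by positivity
      linarith
    | succ t ih =>
      obtain ⟨B, hB⟩ := hB t
      have st := aux_step (𝓕 t) P (𝓕.le t) (Φ t) (Φ (t+1)) (hadapted t) (hmeas _) B hB ρ ν hρ hρν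
        (ϕ t) ζ hζ (hdrift t) (hbdd t)
      have k := mul_le_mul_of_nonneg_left ih hq
      have e : (1 - ζ * ρ / 2) * (2 / (ζ * ρ)) = 2 / (ζ * ρ) - 1 := by field_simp
      have e' : (1 - ζ * ρ / 2) * ((2 / (ζ * ρ)) * Real.exp (ζ * (ν + ϕ t)))
          = (2 / (ζ * ρ) - 1) * Real.exp (ζ * (ν + ϕ t)) := by rw [← mul_assoc, e]
      have mono : (2 / (ζ * ρ)) * Real.exp (ζ * (ν + ϕ t)) ≤
          (2 / (ζ * ρ)) * Real.exp (ζ * (ν + ϕ (t+1))) := by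
        have := hϕmono (Nat.le_succ t)
        gcongr
      have : 0 ≤ ζ * ρ / 2 * Real.exp (ζ * Φ₀) := by positivity
      linarith
  intro t a
  obtain ⟨B, hB⟩ := hB t
  have ch := ProbabilityTheory.measure_ge_le_exp_mul_mgf (μ := P) (X := Φ t) a hζ0.le
    (aux_int_s9 P _ (hmeas t) B ζ hζ0 hB)
  refine ch.trans ?_
  rw [mul_comm]
  gcongr
  exact hM t
end

section
/- Let ρ and ν be reals with 0 < ρ ≤ ν, set ζ = ρ/(ν² + νρ/3), and let a ≥ 0 and b ≥ 0 be reals. Then (1/ζ) · log( exp(ζ a) + (2/(ζ ρ)) · exp(ζ b) ) ≤ (3 ν²/ρ) · log(2 ν/ρ) + a + b. -/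
/-- Logarithmic bound: for `0 < ρ ≤ ν`, `ζ = ρ/(ν² + νρ/3)`, and `a, b ≥ 0`,
`(1/ζ) log(exp(ζa) + (2/(ζρ)) exp(ζb)) ≤ (3ν²/ρ) log(2ν/ρ) + a + b`. -/
theorem stmt_10 (ρ ν a b : ℝ) (hρ : 0 < ρ) (hρν : ρ ≤ ν) (ha : 0 ≤ a) (hb : 0 ≤ b)
    (ζ : ℝ) (hζ : ζ = ρ / (ν ^ 2 + ν * ρ / 3)) :
    (1 / ζ) * Real.log (Real.exp (ζ * a) + (2 / (ζ * ρ)) * Real.exp (ζ * b)) ≤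
      (3 * ν ^ 2 / ρ) * Real.log (2 * ν / ρ) + a + b := by
  have hν : 0 < ν := lt_of_lt_of_le hρ hρν
  have hD : 0 < ν ^ 2 + ν * ρ / 3 := by positivity
  have hz : 0 < ζ := by rw [hζ]; positivity
  have hinv : 1 / ζ = (ν ^ 2 + ν * ρ / 3) / ρ := by rw [hζ, one_div_div]
  have hC : 2 / (ζ * ρ) = 2 * (ν ^ 2 + ν * ρ / 3) / ρ ^ 2 := by
    rw [hζ]; field_simp
  have hC0 : 0 < 2 / (ζ * ρ) := by positivity
  have hy : 1 ≤ 2 * ν / ρ := by rw [le_div_iff₀ hρ]; linarith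
  have hlog : 0 ≤ Real.log (2 * ν / ρ) := Real.log_nonneg hy
  have h1 : 1 + 2 / (ζ * ρ) ≤ (2 * ν / ρ) ^ 2 := by
    rw [hC, div_pow, ← sub_nonneg]
    have : (2 * ν) ^ 2 / ρ ^ 2 - (1 + 2 * (ν ^ 2 + ν * ρ / 3) / ρ ^ 2)
        = (2 * ν ^ 2 - 2 * ν * ρ / 3 - ρ ^ 2) / ρ ^ 2 := by
      field_simp; ring
    rw [this]
    apply div_nonneg _ (by positivity)
    nlinarith
  have h2 : Real.exp (ζ * a) + (2 / (ζ * ρ)) * Real.exp (ζ * b)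
      ≤ (2 * ν / ρ) ^ 2 * Real.exp (ζ * (a + b)) := by
    have e1 : Real.exp (ζ * a) ≤ Real.exp (ζ * (a + b)) :=
      Real.exp_le_exp.2 (by nlinarith)
    have e2 : Real.exp (ζ * b) ≤ Real.exp (ζ * (a + b)) :=
      Real.exp_le_exp.2 (by nlinarith)
    have e3 := mul_le_mul_of_nonneg_left e2 hC0.le
    have e4 := mul_le_mul_of_nonneg_right h1 (Real.exp_pos (ζ * (a + b))).le
    linarith
  have h3 := Real.log_le_log (by positivity) h2
  rw [Real.log_mul (by positivity) (by positivity), Real.log_exp, Real.log_pow] at h3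
  have h4 := mul_le_mul_of_nonneg_left h3 (one_div_pos.2 hz).le
  have h5 : 1 / ζ * 2 ≤ 3 * ν ^ 2 / ρ := by
    rw [hinv, div_mul_eq_mul_div]
    apply div_le_div_of_nonneg_right _ hρ.le
    nlinarith
  have h6 := mul_le_mul_of_nonneg_right h5 hlog
  have h7 : 1 / ζ * (ζ * (a + b)) = a + b := by field_simp
  push_cast at h4
  rw [mul_add, h7] at h4
  linarith
end

section
/- (Elliptical potential lemma.) Let d ≥ 1 and τ ≥ 1 be integers and let φ_1, …, φ_τ ∈ ℝ^d satisfy ‖φ_t‖ ≤ 1 for every t, where ‖·‖ is the Euclidean norm. Define Σ_0 = I_d (the d × d identity matrix) and Σ_t = I_d + Σ_{s=1}^t φ_s φ_sᵀ for t ≥ 1. Then each Σ_t is positive definite and Σ_{t=1}^{τ} min(1, φ_tᵀ Σ_{t−1}⁻¹ φ_t) ≤ 2 log( det Σ_τ / det Σ_0 ) ≤ 2 d log( (d + τ)/d ). -/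
open Matrix

lemma aux_min_log (x : ℝ) (hx : 0 ≤ x) : min 1 x ≤ 2 * Real.log (1 + x) := by
  set y := min 1 x with hy
  have h0 : 0 ≤ y := le_min zero_le_one hx
  have h1 : y ≤ 1 := min_le_left _ _
  have h2 : y ≤ x := min_le_right _ _
  have h3 : Real.log (1 + y) ≤ Real.log (1 + x) := Real.log_le_log (by linarith) (by linarith)
  have h4 : 1 - (1 + y)⁻¹ ≤ Real.log (1 + y) := Real.one_sub_inv_le_log_of_pos (by linarith)
  have h5 : y / 2 ≤ 1 - (1 + y)⁻¹ := by
    have : 1 - (1 + y)⁻¹ = y / (1 + y) := by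
      field_simp
      ring
    rw [this]
    exact div_le_div_of_nonneg_left h0 (by linarith) (by linarith)
  linarith

lemma aux_det {d : ℕ} (A : Matrix (Fin d) (Fin d) ℝ) (hA : A.PosDef) (v : Fin d → ℝ) :
    (A + vecMulVec v v).det = A.det * (1 + v ⬝ᵥ (A⁻¹ *ᵥ v)) := by
  have hu : IsUnit A.det := hA.det_pos.ne'.isUnit
  rw [vecMulVec_eq Unit, det_add_replicateCol_mul_replicateRow hu]
  congr 1
  rw [det_unique]
  simp [Matrix.mul_assoc, Matrix.mul_apply, dotProduct, mulVec]

lemma aux_logdet {d : ℕ} (A : Matrix (Fin d) (Fin d) ℝ) (hA : A.PosDef) (m : ℝ) (hm : 0 < m)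
    (htr : A.trace ≤ d * m) : Real.log A.det ≤ d * Real.log m := by
  have hdet : A.det = ∏ i, hA.1.eigenvalues i := by
    simpa using hA.1.det_eq_prod_eigenvalues
  have htr' : A.trace = ∑ i, hA.1.eigenvalues i := by
    simpa using hA.1.trace_eq_sum_eigenvalues
  rw [hdet, Real.log_prod (fun i _ => (hA.eigenvalues_pos i).ne')]
  have h : ∀ i, Real.log (hA.1.eigenvalues i) ≤ hA.1.eigenvalues i / m - 1 + Real.log m := by
    intro i
    have hp := hA.eigenvalues_pos i
    have := Real.log_le_sub_one_of_pos (div_pos hp hm)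
    rw [Real.log_div hp.ne' hm.ne'] at this
    linarith
  have h2 := Finset.sum_le_sum (fun i (_ : i ∈ Finset.univ) => h i)
  refine h2.trans ?_
  rw [Finset.sum_add_distrib, Finset.sum_sub_distrib, ← Finset.sum_div, ← htr']
  simp only [Finset.sum_const, Finset.card_univ, Fintype.card_fin, nsmul_eq_mul, mul_one]
  have : A.trace / m ≤ d := by
    rw [div_le_iff₀ hm]
    exact htr
  linarith

/-- Elliptical potential lemma: with `Σ_t = I + Σ_{s≤t} φ_s φ_sᵀ` and `‖φ_t‖ ≤ 1`, each
`Σ_t` is positive definite and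
`Σ_{t=1}^τ min(1, φ_tᵀ Σ_{t−1}⁻¹ φ_t) ≤ 2 log(det Σ_τ / det Σ_0) ≤ 2d log((d+τ)/d)`. -/
theorem stmt_12 {d τ : ℕ} (hd : 1 ≤ d) (hτ : 1 ≤ τ)
    (φ : ℕ → Fin d → ℝ)
    (hφ : ∀ t ∈ Finset.Icc 1 τ, Real.sqrt (∑ i, φ t i ^ 2) ≤ 1)
    (Sig : ℕ → Matrix (Fin d) (Fin d) ℝ)
    (hSig : ∀ t, Sig t = 1 + ∑ s ∈ Finset.Icc 1 t, vecMulVec (φ s) (φ s)) :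
    (∀ t, (Sig t).PosDef) ∧
      (∑ t ∈ Finset.Icc 1 τ, min 1 (φ t ⬝ᵥ ((Sig (t - 1))⁻¹ *ᵥ φ t)) ≤
        2 * Real.log ((Sig τ).det / (Sig 0).det)) ∧
      2 * Real.log ((Sig τ).det / (Sig 0).det) ≤
        2 * d * Real.log ((d + τ) / d) := by
  have hS0 : Sig 0 = 1 := by simp [hSig 0]
  have hstep : ∀ t, Sig (t + 1) = Sig t + vecMulVec (φ (t + 1)) (φ (t + 1)) := by
    intro t
    rw [hSig, hSig, Finset.sum_Icc_succ_top (by omega), add_assoc]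
  have hpos : ∀ t, (Sig t).PosDef := by
    intro t
    induction t with
    | zero => rw [hS0]; exact PosDef.one
    | succ t ih =>
      rw [hstep]
      refine ih.add_posSemidef ?_
      simpa using posSemidef_vecMulVec_self_star (φ (t + 1))
  have hd0 : (0 : ℝ) < d := by exact_mod_cast hd
  have hdiv : ∀ t, (Sig t).det / (Sig 0).det = (Sig t).det := by
    intro t
    simp [hS0]
  refine ⟨hpos, ?_, ?_⟩
  · rw [hdiv]
    clear hφ hτ
    induction τ with
    | zero => simp [hS0]
    | succ n ih =>
      rw [Finset.sum_Icc_succ_top (by omega), hstep, aux_det _ (hpos n), Nat.add_sub_cancel]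
      have hx : 0 ≤ φ (n + 1) ⬝ᵥ ((Sig n)⁻¹ *ᵥ φ (n + 1)) := by
        simpa using (hpos n).inv.posSemidef.dotProduct_mulVec_nonneg (φ (n + 1))
      rw [Real.log_mul (hpos n).det_pos.ne' (by linarith), mul_add]
      exact add_le_add ih (aux_min_log _ hx)
  · rw [hdiv, mul_assoc]
    refine mul_le_mul_of_nonneg_left (aux_logdet _ (hpos τ) _ (by positivity) ?_) (by norm_num)
    rw [mul_div_cancel₀ _ hd0.ne', hSig, trace_add, trace_one, trace_sum, Fintype.card_fin]
    gcongr
    calc ∑ s ∈ Finset.Icc 1 τ, (vecMulVec (φ s) (φ s)).trace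
        ≤ ∑ s ∈ Finset.Icc 1 τ, (1 : ℝ) := by
          refine Finset.sum_le_sum fun s hs => ?_
          have := Real.sqrt_le_one.mp (hφ s hs)
          simpa [trace_vecMulVec, dotProduct, sq] using this
      _ = τ := by simp
end
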